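/- arXiv:2111.03273 — 3 statements merged into one kernel-verified Lean document; each statement's English description precedes it below -/
import Mathlib

section
/- For all integers d ≥ 1 and k ≥ 1, the matrix-valued integral of the k-fold tensor power of a uniformly random pure state equals the normalized sum of permutation operators: C(d+k-1, k) · ∫ |φ⟩⟨φ|^{⊗k} dμ_d(φ) = (k!)^{-1} Σ_{π ∈ S_k} P_d(π) (an identity of matrices indexed by (Fin k → Fin d)), and consequently the trace of the right-hand side (the projector onto the symmetric subspace) equals C(d+k-1, k). -/
open MeasureTheory

noncomputable section

/-- `ℂ^d`. -/
abbrev Cvec (d : ℕ) : Type := EuclideanSpace ℂ (Fin d)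

instance (d : ℕ) : MeasurableSpace (Cvec d) := borel _
instance (d : ℕ) : BorelSpace (Cvec d) := ⟨rfl⟩

/-- The unit sphere of `ℂ^d`. -/
abbrev USphere (d : ℕ) := Metric.sphere (0 : Cvec d) 1

/-- The action of a unitary (linear isometric equivalence) on the unit sphere. -/
def sphereRot (d : ℕ) (e : Cvec d ≃ₗᵢ[ℂ] Cvec d) (x : USphere d) : USphere d :=
  ⟨e x, by
    have hx : ‖(x : Cvec d)‖ = 1 := mem_sphere_zero_iff_norm.mp x.2
    simp [mem_sphere_zero_iff_norm, e.norm_map, hx]⟩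

/-- `μ` is the uniform (rotation-invariant) probability measure on the unit sphere of `ℂ^d`. -/
def IsUniformOnSphere (d : ℕ) (μ : Measure (USphere d)) : Prop :=
  IsProbabilityMeasure μ ∧
    ∀ e : Cvec d ≃ₗᵢ[ℂ] Cvec d, μ.map (sphereRot d e) = μ

/-- `|φ⟩⟨φ|^{⊗k}`, as a matrix indexed by `Fin k → Fin d`. -/
def ketbraPow (d k : ℕ) (φ : Cvec d) : Matrix (Fin k → Fin d) (Fin k → Fin d) ℂ :=
  fun i j => ∏ a : Fin k, φ (i a) * star (φ (j a))

/-- The permutation operator `P_d(π)` on `(ℂ^d)^{⊗k}`. -/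
def permMat (d k : ℕ) (π : Equiv.Perm (Fin k)) : Matrix (Fin k → Fin d) (Fin k → Fin d) ℂ :=
  fun i j => if i = j ∘ π then 1 else 0

/-- The occupation numbers of a word `i`. -/
def occupation {d k : ℕ} (i : Fin k → Fin d) : Fin d →₀ ℕ :=
  ∑ a, Finsupp.single (i a) 1

open Finset in
lemma occupation_apply {d k : ℕ} (i : Fin k → Fin d) (c : Fin d) :
    occupation i c = #{a | i a = c} := by
  simp [occupation, Finsupp.finsetSum_apply, Finsupp.single_apply]

lemma prod_apply_eq_prod_pow_occupation {R : Type*} [CommMonoid R] {d k : ℕ}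
    (i : Fin k → Fin d) (f : Fin d → R) :
    ∏ a, f (i a) = ∏ c, f c ^ occupation i c := by
  simp_rw [occupation_apply]
  rw [← Finset.prod_fiberwise Finset.univ i]
  refine Finset.prod_congr rfl fun c _ => ?_
  rw [Finset.prod_congr rfl (g := fun _ => f c), Finset.prod_const]
  intro a ha
  rw [(Finset.mem_filter.mp ha).2]

lemma occupation_comp_perm {d k : ℕ} (i : Fin k → Fin d) (π : Equiv.Perm (Fin k)) :
    occupation (i ∘ π) = occupation i :=
  Equiv.sum_comp π fun a => Finsupp.single (i a) 1

lemma exists_perm_of_occupation_eq {d k : ℕ} {i j : Fin k → Fin d}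
    (h : occupation i = occupation j) : ∃ π : Equiv.Perm (Fin k), i = j ∘ π := by
  have e (c : Fin d) : Nonempty ({a // i a = c} ≃ {a // j a = c}) := by
    rw [← Fintype.card_eq, Fintype.card_subtype, Fintype.card_subtype, ← occupation_apply,
      ← occupation_apply, h]
  exact ⟨Equiv.ofFiberEquiv fun c => (e c).some,
    funext fun a => (Equiv.ofFiberEquiv_map _ a).symm⟩

open Finset in
lemma image_occupation (d k : ℕ) :
    (univ : Finset (Fin k → Fin d)).image occupation = univ.finsuppAntidiag k := by
  ext n
  simp only [mem_image, mem_univ, true_and, mem_finsuppAntidiag, subset_univ, and_true]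
  constructor
  · rintro ⟨i, rfl⟩
    simp_rw [occupation_apply]
    rw [← card_eq_sum_card_fiberwise (fun _ _ => mem_coe.mpr (mem_univ _))]
    simp
  · intro hn
    have hc : Fintype.card (Σ c, Fin (n c)) = k := by simpa using hn
    let e := Fintype.equivFinOfCardEq hc
    refine ⟨fun a => (e.symm a).1, Finsupp.ext fun c => ?_⟩
    rw [occupation_apply, ← Fintype.card_subtype]
    calc _ = Fintype.card {x : Σ c, Fin (n c) // x.1 = c} :=
          Fintype.card_congr (e.symm.subtypeEquiv fun _ => Iff.rfl)
      _ = Fintype.card (Fin (n c)) := Fintype.card_congr (Equiv.sigmaSubtype c)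
      _ = n c := Fintype.card_fin _

open Finset in
lemma card_perm_mul_card_occupation_class {d k : ℕ} {i j : Fin k → Fin d}
    (h : occupation i = occupation j) :
    #{π : Equiv.Perm (Fin k) | i = j ∘ π} * #{l : Fin k → Fin d | occupation l = occupation i} =
      k.factorial := by
  have key : #(univ : Finset (Equiv.Perm (Fin k))) =
      ∑ l ∈ {l : Fin k → Fin d | occupation l = occupation i},
        #{π : Equiv.Perm (Fin k) | j ∘ π = l} :=
    card_eq_sum_card_fiberwise (f := fun π : Equiv.Perm (Fin k) => j ∘ π)
      fun π _ => by simp [occupation_comp_perm, h]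
  rw [sum_congr rfl (g := fun _ => #{π : Equiv.Perm (Fin k) | i = j ∘ π}), sum_const,
    card_univ, Fintype.card_perm, Fintype.card_fin, smul_eq_mul, mul_comm] at key
  · exact key.symm
  · intro l hl
    obtain ⟨σ, rfl⟩ := exists_perm_of_occupation_eq (mem_filter.mp hl).2
    symm
    refine card_equiv (Equiv.mulRight σ) fun π => ?_
    simp only [mem_filter, mem_univ, true_and, Equiv.coe_mulRight, Equiv.Perm.coe_mul]
    rw [← Function.comp_assoc, eq_comm]
    exact (σ.surjective.injective_comp_right.eq_iff).symm

open Finset in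
lemma sum_inv_card_occupation_class (d k : ℕ) :
    ∑ i : Fin k → Fin d, (#{l : Fin k → Fin d | occupation l = occupation i} : ℂ)⁻¹ =
      ((d + k - 1).choose k : ℂ) := by
  rw [← sum_fiberwise_of_maps_to (t := univ.finsuppAntidiag k) (g := occupation)
    (fun i hi => image_occupation d k ▸ mem_image_of_mem _ hi)]
  rw [sum_congr rfl (g := fun _ => (1 : ℂ))]
  · simp [card_finsuppAntidiag_nat_eq_choose]
  · intro n hn
    rw [← image_occupation, mem_image] at hn
    obtain ⟨i, -, rfl⟩ := hn
    rw [sum_congr rfl (g := fun _ => (#{l : Fin k → Fin d | occupation l = occupation i} : ℂ)⁻¹),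
      sum_const, nsmul_eq_mul, mul_inv_cancel₀]
    · exact Nat.cast_ne_zero.mpr (card_ne_zero.mpr ⟨i, by simp⟩)
    · intro l hl
      rw [(mem_filter.mp hl).2]

open Finset in
lemma sum_permMat_apply (d k : ℕ) (i j : Fin k → Fin d) :
    (((k.factorial : ℂ))⁻¹ • ∑ π : Equiv.Perm (Fin k), permMat d k π) i j =
      if occupation i = occupation j then
        (#{l : Fin k → Fin d | occupation l = occupation i} : ℂ)⁻¹ else 0 := by
  have hs : (((k.factorial : ℂ))⁻¹ • ∑ π : Equiv.Perm (Fin k), permMat d k π) i j =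
      ((k.factorial : ℂ))⁻¹ * #{π : Equiv.Perm (Fin k) | i = j ∘ π} := by
    simp [Matrix.sum_apply, permMat]
  rw [hs]
  split_ifs with h
  · have := card_perm_mul_card_occupation_class h
    rw [← this]
    have h0 : (#{π : Equiv.Perm (Fin k) | i = j ∘ π} : ℂ) ≠ 0 := by
      obtain ⟨π, hπ⟩ := exists_perm_of_occupation_eq h
      exact Nat.cast_ne_zero.mpr (card_ne_zero.mpr ⟨π, by simpa using hπ⟩)
    push_cast
    field_simp
  · rw [filter_eq_empty_iff.mpr]
    · simp
    · rintro π - rfl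
      exact h (occupation_comp_perm j π)

lemma ketbraPow_apply (d k : ℕ) (φ : Cvec d) (i j : Fin k → Fin d) :
    ketbraPow d k φ i j = (∏ a, φ (i a)) * star (∏ a, φ (j a)) := by
  simp [ketbraPow, Finset.prod_mul_distrib]

lemma ketbraPow_congr {d k : ℕ} (φ : Cvec d) {i i' j j' : Fin k → Fin d}
    (hi : occupation i = occupation i') (hj : occupation j = occupation j') :
    ketbraPow d k φ i j = ketbraPow d k φ i' j' := by
  simp_rw [ketbraPow_apply, prod_apply_eq_prod_pow_occupation _ (fun c => φ c), hi, hj]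

lemma continuous_sphereRot (d : ℕ) (e : Cvec d ≃ₗᵢ[ℂ] Cvec d) : Continuous (sphereRot d e) :=
  (e.continuous.comp continuous_subtype_val).subtype_mk _

section Uniform

variable {d k : ℕ} {μ : Measure (USphere d)}

lemma IsUniformOnSphere.integrable (hμ : IsUniformOnSphere d μ) {f : Cvec d → ℂ}
    (hf : Continuous f) : Integrable (fun φ : USphere d => f φ) μ := by
  have := hμ.1
  exact (hf.comp continuous_subtype_val).integrable_of_hasCompactSupport
    (HasCompactSupport.of_compactSpace _)

lemma IsUniformOnSphere.integral_comp (hμ : IsUniformOnSphere d μ) {f : Cvec d → ℂ}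
    (hf : Continuous f) (e : Cvec d ≃ₗᵢ[ℂ] Cvec d) :
    ∫ φ : USphere d, f (e φ) ∂μ = ∫ φ : USphere d, f φ ∂μ := by
  conv_rhs => rw [← hμ.2 e]
  rw [integral_map (continuous_sphereRot d e).aemeasurable
    (f := fun φ : USphere d => f φ) (hf.comp continuous_subtype_val).aestronglyMeasurable]
  rfl

lemma continuous_ketbraPow (i j : Fin k → Fin d) :
    Continuous fun φ : Cvec d => ketbraPow d k φ i j := by
  unfold ketbraPow
  fun_prop

/-- Multiplication by a complex number of modulus one, as an isometry of `ℂ`. -/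
def phaseIsometry (z : ℂ) (hz : ‖z‖ = 1) : ℂ ≃ₗᵢ[ℂ] ℂ where
  toLinearEquiv := LinearEquiv.smulOfNeZero ℂ ℂ z (norm_ne_zero_iff.mp (hz ▸ one_ne_zero))
  norm_map' x := by simp [hz]

lemma IsUniformOnSphere.integral_ketbraPow_eq_zero (hμ : IsUniformOnSphere d μ)
    {i j : Fin k → Fin d} (h : occupation i ≠ occupation j) :
    ∫ φ : USphere d, ketbraPow d k φ i j ∂μ = 0 := by
  obtain ⟨c, hc⟩ := DFunLike.ne_iff.mp h
  have hc' : ((occupation i c : ℂ) - occupation j c) ≠ 0 :=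
    sub_ne_zero.mpr (Nat.cast_injective.ne hc)
  set θ : ℝ := Real.pi / ((occupation i c : ℝ) - occupation j c) with hθ
  set z : ℂ := Complex.exp (θ * Complex.I) with hz
  have hzn : ‖z‖ = 1 := Complex.norm_exp_ofReal_mul_I θ
  have hphase : z ^ occupation i c * star z ^ occupation j c = -1 := by
    rw [hz, Complex.star_def, ← Complex.exp_conj, ← Complex.exp_nat_mul, ← Complex.exp_nat_mul,
      ← Complex.exp_add, ← Complex.exp_pi_mul_I]
    congr 1
    simp only [hθ, map_mul, Complex.conj_ofReal, Complex.conj_I]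
    push_cast
    field_simp
    ring
  let w : Fin d → ℂ := Function.update 1 c z
  have hw (a : Fin d) : ‖w a‖ = 1 := by
    by_cases ha : a = c
    · subst ha; simpa [w] using hzn
    · simp [w, ha]
  have hprod (l : Fin k → Fin d) : ∏ a, w (l a) = z ^ occupation l c := by
    rw [prod_apply_eq_prod_pow_occupation, Finset.prod_eq_single c]
    · simp [w]
    · intro b _ hb
      simp [w, hb]
    · simp
  let e : Cvec d ≃ₗᵢ[ℂ] Cvec d :=
    LinearIsometryEquiv.piLpCongrRight 2 fun a => phaseIsometry (w a) (hw a)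
  have he (φ : Cvec d) (a : Fin d) : e φ a = w a * φ a := rfl
  have hneg (φ : Cvec d) : ketbraPow d k (e φ) i j = -ketbraPow d k φ i j := by
    rw [ketbraPow_apply, ketbraPow_apply]
    simp only [he, Finset.prod_mul_distrib, star_mul', hprod, star_pow]
    linear_combination ((∏ a, φ (i a)) * star (∏ a, φ (j a))) * hphase
  have := hμ.integral_comp (continuous_ketbraPow i j) e
  simp_rw [hneg, integral_neg] at this
  exact self_eq_neg.mp this.symm

open scoped InnerProductSpace in
lemma IsUniformOnSphere.integral_inner_pow (hμ : IsUniformOnSphere d μ) (c₀ : Fin d)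
    (v : Cvec d) (hv : v ≠ 0) :
    ∫ φ : USphere d, ⟪v, (φ : Cvec d)⟫_ℂ ^ k * star (⟪v, (φ : Cvec d)⟫_ℂ ^ k) ∂μ =
      ((‖v‖ : ℂ) ^ 2) ^ k *
        ∫ φ : USphere d, (φ : Cvec d) c₀ ^ k * star ((φ : Cvec d) c₀ ^ k) ∂μ := by
  have hv' : ‖v‖ ≠ 0 := norm_ne_zero_iff.mpr hv
  set u : Cvec d := (‖v‖ : ℂ)⁻¹ • v with hu
  have hun : ‖u‖ = 1 := by simp [hu, norm_smul, hv']
  have hvu : v = (‖v‖ : ℂ) • u := by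
    rw [hu, smul_inv_smul₀ (Complex.ofReal_ne_zero.mpr hv')]
  obtain ⟨b, hb⟩ := Orthonormal.exists_orthonormalBasis_extension_of_card_eq (𝕜 := ℂ)
    (E := Cvec d) (ι := Fin d) (by simp) (v := fun _ => u) (s := {c₀})
    ⟨fun _ => hun, fun x y hxy => absurd (Subsingleton.elim x y) hxy⟩
  have hbc (φ : Cvec d) : b.repr φ c₀ = ⟪u, φ⟫_ℂ := by
    rw [b.repr_apply_apply, hb c₀ rfl]
  rw [← hμ.integral_comp (f := fun φ => φ c₀ ^ k * star (φ c₀ ^ k)) (by fun_prop) b.repr,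
    ← integral_const_mul]
  refine integral_congr_ae (.of_forall fun φ => ?_)
  simp only [hbc]
  conv_lhs => rw [hvu]
  rw [inner_smul_left, mul_pow, star_mul', star_pow, star_pow]
  simp only [Complex.conj_ofReal, Complex.star_def]
  ring

open scoped InnerProductSpace in
open Finset in
lemma IsUniformOnSphere.sum_mul_prod (hμ : IsUniformOnSphere d μ) (c₀ : Fin d)
    (t : Fin d → ℝ) (ht : ∀ c, 0 < t c) :
    ∑ i : Fin k → Fin d, (#{l : Fin k → Fin d | occupation l = occupation i} : ℂ) *
        (∫ φ : USphere d, ketbraPow d k φ i i ∂μ) * ∏ a, (t (i a) : ℂ) =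
      (∫ φ : USphere d, (φ : Cvec d) c₀ ^ k * star ((φ : Cvec d) c₀ ^ k) ∂μ) *
        ∑ i : Fin k → Fin d, ∏ a, (t (i a) : ℂ) := by
  set r : Fin d → ℝ := fun c => √(t c)
  have hr (c : Fin d) : (r c : ℂ) * r c = t c := by
    rw [← Complex.ofReal_mul, Real.mul_self_sqrt (ht c).le]
  let v : Cvec d := WithLp.toLp 2 fun c => (r c : ℂ)
  have hv : v ≠ 0 := fun h => by
    have : (r c₀ : ℂ) = 0 := congrArg (fun x : Cvec d => x c₀) h
    exact (Real.sqrt_pos.mpr (ht c₀)).ne' (Complex.ofReal_eq_zero.mp this)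
  have hnorm : (‖v‖ : ℂ) ^ 2 = ∑ c, (t c : ℂ) := by
    rw [← Complex.ofReal_pow, EuclideanSpace.norm_sq_eq]
    push_cast
    refine sum_congr rfl fun c _ => ?_
    rw [← hr, ← sq, ← Complex.ofReal_pow, ← Complex.ofReal_pow]
    simp [v]
  have hinner (φ : Cvec d) : ⟪v, φ⟫_ℂ ^ k = ∑ i : Fin k → Fin d,
      (∏ a, (r (i a) : ℂ)) * ∏ a, φ (i a) := by
    rw [PiLp.inner_apply, Fintype.sum_pow]
    refine sum_congr rfl fun i _ => ?_
    rw [← prod_mul_distrib]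
    refine prod_congr rfl fun a _ => ?_
    simp [v, mul_comm]
  have key := hμ.integral_inner_pow (k := k) c₀ v hv
  rw [hnorm, Fintype.sum_pow, mul_comm] at key
  rw [← key]
  have hexp (φ : Cvec d) : ⟪v, φ⟫_ℂ ^ k * star (⟪v, φ⟫_ℂ ^ k) =
      ∑ i : Fin k → Fin d, ∑ j : Fin k → Fin d,
        ((∏ a, (r (i a) : ℂ)) * ∏ a, (r (j a) : ℂ)) * ketbraPow d k φ i j := by
    rw [hinner, star_sum, sum_mul_sum]
    refine sum_congr rfl fun i _ => sum_congr rfl fun j _ => ?_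
    rw [ketbraPow_apply, star_mul', star_prod]
    simp only [Complex.star_def, Complex.conj_ofReal]
    ring
  simp_rw [hexp]
  rw [integral_finsetSum _ fun i _ => integrable_finsetSum _ fun j _ =>
    (hμ.integrable (continuous_ketbraPow i j)).const_mul _]
  refine sum_congr rfl fun i _ => ?_
  rw [integral_finsetSum _ fun j _ => (hμ.integrable (continuous_ketbraPow i j)).const_mul _]
  simp_rw [integral_const_mul]
  rw [← sum_filter_add_sum_filter_not univ (fun l => occupation l = occupation i),
    sum_eq_zero (s := {l | ¬ occupation l = occupation i}), add_zero,
    sum_congr rfl (g := fun _ => (∏ a, (t (i a) : ℂ)) *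
      ∫ φ : USphere d, ketbraPow d k φ i i ∂μ), sum_const, nsmul_eq_mul]
  · ring
  · intro l hl
    have hl' := (mem_filter.mp hl).2
    simp_rw [ketbraPow_congr _ rfl hl']
    rw [prod_apply_eq_prod_pow_occupation l fun c => (r c : ℂ), hl',
      ← prod_apply_eq_prod_pow_occupation i fun c => (r c : ℂ), ← prod_mul_distrib]
    simp_rw [hr]
  · intro l hl
    rw [hμ.integral_ketbraPow_eq_zero fun h => (mem_filter.mp hl).2 h.symm, mul_zero]

open Finset in
lemma IsUniformOnSphere.card_mul_integral_ketbraPow_self (hμ : IsUniformOnSphere d μ)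
    (c₀ : Fin d) (i : Fin k → Fin d) :
    (#{l : Fin k → Fin d | occupation l = occupation i} : ℂ) *
        (∫ φ : USphere d, ketbraPow d k φ i i ∂μ) =
      ∫ φ : USphere d, (φ : Cvec d) c₀ ^ k * star ((φ : Cvec d) c₀ ^ k) ∂μ := by
  set K := ∫ φ : USphere d, (φ : Cvec d) c₀ ^ k * star ((φ : Cvec d) c₀ ^ k) ∂μ with hK
  let A (l : Fin k → Fin d) : ℂ := (#{m : Fin k → Fin d | occupation m = occupation l} : ℂ) *
    (∫ φ : USphere d, ketbraPow d k φ l l ∂μ) - K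
  have hA {l : Fin k → Fin d} (hl : occupation l = occupation i) : A l = A i := by
    simp only [A, hl]
    simp_rw [ketbraPow_congr _ hl hl]
  let P : MvPolynomial (Fin d) ℂ := ∑ l : Fin k → Fin d, MvPolynomial.monomial (occupation l) (A l)
  have hP : P = 0 := by
    refine MvPolynomial.funext_set (fun _ => Complex.ofReal '' Set.Ioi 0)
      (fun _ => (Set.Ioi_infinite 0).image Complex.ofReal_injective.injOn) fun x hx => ?_
    choose t ht htx using fun c => hx c (Set.mem_univ c)
    obtain rfl : (fun c => (t c : ℂ)) = x := funext htx
    have := hμ.sum_mul_prod (k := k) c₀ t ht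
    rw [← hK, mul_sum, ← sub_eq_zero, ← sum_sub_distrib] at this
    simp only [P, map_sum, map_zero, MvPolynomial.eval_monomial]
    rw [← this]
    refine sum_congr rfl fun l _ => ?_
    rw [Finsupp.prod_fintype _ _ fun _ => pow_zero _,
      ← prod_apply_eq_prod_pow_occupation l fun c => (t c : ℂ)]
    simp only [A]
    ring
  have hcoeff := congrArg (MvPolynomial.coeff (occupation i)) hP
  simp only [P, MvPolynomial.coeff_sum, MvPolynomial.coeff_monomial, MvPolynomial.coeff_zero]
    at hcoeff
  rw [← sum_filter, sum_congr rfl (g := fun _ => A i) fun l hl => hA (mem_filter.mp hl).2,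
    sum_const, nsmul_eq_mul, mul_eq_zero, Nat.cast_eq_zero] at hcoeff
  exact sub_eq_zero.mp (hcoeff.resolve_left (card_ne_zero.mpr ⟨i, by simp⟩))

lemma IsUniformOnSphere.sum_integral_ketbraPow_self (hμ : IsUniformOnSphere d μ) :
    ∑ i : Fin k → Fin d, ∫ φ : USphere d, ketbraPow d k φ i i ∂μ = 1 := by
  have := hμ.1
  rw [← integral_finsetSum _ fun i _ => hμ.integrable (continuous_ketbraPow i i)]
  have h (φ : USphere d) : ∑ i : Fin k → Fin d, ketbraPow d k φ i i = 1 := by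
    simp only [ketbraPow]
    rw [← Fintype.sum_pow (fun c => (φ : Cvec d) c * star ((φ : Cvec d) c))]
    have hn : ‖(φ : Cvec d)‖ ^ 2 = 1 := by simp [mem_sphere_zero_iff_norm.mp φ.2]
    rw [EuclideanSpace.norm_sq_eq] at hn
    simp only [Complex.star_def, Complex.mul_conj']
    rw [← one_pow k]
    congr 1
    exact_mod_cast hn
  simp [h]

end Uniform

/-- `C(d+k-1,k) · ∫ |φ⟩⟨φ|^{⊗k} dμ_d(φ) = (k!)⁻¹ Σ_{π ∈ S_k} P_d(π)`,
and the trace of the right-hand side equals `C(d+k-1,k)`. -/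
theorem stmt0 (d k : ℕ) (hd : 1 ≤ d) (hk : 1 ≤ k)
    (μ : Measure (USphere d)) (hμ : IsUniformOnSphere d μ) :
    ((Nat.choose (d + k - 1) k : ℂ) •
        ((fun i j => ∫ φ : USphere d, ketbraPow d k (↑φ) i j ∂μ) :
          Matrix (Fin k → Fin d) (Fin k → Fin d) ℂ)
      = ((k.factorial : ℂ))⁻¹ • ∑ π : Equiv.Perm (Fin k), permMat d k π) ∧
    Matrix.trace (((k.factorial : ℂ))⁻¹ • ∑ π : Equiv.Perm (Fin k), permMat d k π)
      = (Nat.choose (d + k - 1) k : ℂ) := by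
  have htrace : Matrix.trace (((k.factorial : ℂ))⁻¹ • ∑ π : Equiv.Perm (Fin k), permMat d k π)
      = (Nat.choose (d + k - 1) k : ℂ) := by
    rw [← sum_inv_card_occupation_class, Matrix.trace]
    refine Finset.sum_congr rfl fun i _ => ?_
    rw [Matrix.diag_apply, sum_permMat_apply, if_pos rfl]
  refine ⟨?_, htrace⟩
  have hcard (i : Fin k → Fin d) :
      ((Finset.univ.filter fun l : Fin k → Fin d => occupation l = occupation i).card : ℂ) ≠ 0 :=
    Nat.cast_ne_zero.mpr (Finset.card_ne_zero.mpr ⟨i, by simp⟩)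
  let K := ∫ φ : USphere d, (φ : Cvec d) ⟨0, hd⟩ ^ k * star ((φ : Cvec d) ⟨0, hd⟩ ^ k) ∂μ
  have hdiag (i : Fin k → Fin d) : ∫ φ : USphere d, ketbraPow d k φ i i ∂μ =
      ((Finset.univ.filter fun l : Fin k → Fin d => occupation l = occupation i).card : ℂ)⁻¹ * K :=
    (eq_inv_mul_iff_mul_eq₀ (hcard i)).mpr (hμ.card_mul_integral_ketbraPow_self _ i)
  have hK : (Nat.choose (d + k - 1) k : ℂ) * K = 1 := by
    rw [← hμ.sum_integral_ketbraPow_self (k := k), ← sum_inv_card_occupation_class,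
      Finset.sum_mul]
    exact Finset.sum_congr rfl fun i _ => (hdiag i).symm
  ext i j
  rw [sum_permMat_apply]
  change (Nat.choose (d + k - 1) k : ℂ) * ∫ φ : USphere d, ketbraPow d k φ i j ∂μ = _
  split_ifs with h
  · simp_rw [ketbraPow_congr _ rfl h.symm]
    rw [hdiag, mul_left_comm, hK, mul_one]
  · rw [hμ.integral_ketbraPow_eq_zero h, mul_zero]

end
end

section
/- Let d ≥ 1, k ≥ 1, and let M be a positive semidefinite complex matrix indexed by (Fin k → Fin d) with Tr(M · P_sym^{d,k}) > 0, where P_sym^{d,k} = (k!)^{-1} Σ_{π∈S_k} P_d(π). Then the matrix (C(d+k-1,k)/Tr(M·P_sym^{d,k})) · ∫ Tr(M·|φ⟩⟨φ|^{⊗k}) · |φ⟩⟨φ|^{⊗k} dμ_d(φ) − e^{−k²/d} · C(d+k-1,k)^{-1} · P_sym^{d,k} is positive semidefinite. -/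
open MeasureTheory
open scoped ComplexOrder

noncomputable section

/-- The projector `P_sym^{d,k} = (k!)⁻¹ Σ_{π ∈ S_k} P_d(π)` onto the symmetric subspace. -/
def PsymM (d k : ℕ) : Matrix (Fin k → Fin d) (Fin k → Fin d) ℂ :=
  ((k.factorial : ℂ))⁻¹ • ∑ π : Equiv.Perm (Fin k), permMat d k π

/-- The (unnormalized) post-measurement state `∫ Tr(M |φ⟩⟨φ|^{⊗k}) |φ⟩⟨φ|^{⊗k} dμ(φ)`. -/
def postState (d k : ℕ) (μ : Measure (USphere d))
    (M : Matrix (Fin k → Fin d) (Fin k → Fin d) ℂ) :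
    Matrix (Fin k → Fin d) (Fin k → Fin d) ℂ :=
  fun i j => ∫ φ : USphere d, (M * ketbraPow d k (↑φ)).trace * ketbraPow d k (↑φ) i j ∂μ


/-- The monomial `φ^α`. -/
def vecMonomial {d : ℕ} (φ : Cvec d) (α : Fin d → ℕ) : ℂ := ∏ x, φ x ^ α x

/-- The mixed moment `∫ φ^α conj(φ^β) dμ(φ)` of a measure on the sphere. -/
def sphereMoment {d : ℕ} (μ : Measure (USphere d)) (α β : Fin d → ℕ) : ℂ :=
  ∫ φ : USphere d, vecMonomial (φ : Cvec d) α * star (vecMonomial (φ : Cvec d) β) ∂μ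

@[fun_prop]
lemma continuous_vecMonomial {d : ℕ} (α : Fin d → ℕ) :
    Continuous fun φ : USphere d => vecMonomial (φ : Cvec d) α := by
  unfold vecMonomial
  fun_prop

lemma integrable_sphere {d : ℕ} {μ : Measure (USphere d)} [IsFiniteMeasure μ]
    {f : USphere d → ℂ} (hf : Continuous f) : Integrable f μ :=
  hf.integrable_of_hasCompactSupport (HasCompactSupport.of_compactSpace f)

lemma IsUniformOnSphere.integral_rot {d : ℕ} {μ : Measure (USphere d)}
    (hμ : IsUniformOnSphere d μ) (e : Cvec d ≃ₗᵢ[ℂ] Cvec d) {f : USphere d → ℂ}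
    (hf : Continuous f) : ∫ φ, f (sphereRot d e φ) ∂μ = ∫ φ, f φ ∂μ := by
  have hc : Continuous (sphereRot d e) :=
    Continuous.subtype_mk (e.continuous.comp continuous_subtype_val) _
  conv_rhs => rw [← hμ.2 e]
  rw [integral_map hc.aemeasurable hf.aestronglyMeasurable]

lemma exists_linearIsometryEquiv_apply_eq {d : ℕ} {u v : Cvec d} (h : ‖u‖ = ‖v‖) :
    ∃ e : Cvec d ≃ₗᵢ[ℂ] Cvec d, e u = v := by
  by_cases hu : u = 0
  · subst hu
    refine ⟨LinearIsometryEquiv.refl ℂ _, ?_⟩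
    simpa using (norm_eq_zero.1 (h.symm.trans norm_zero)).symm
  let L : Submodule.span ℂ {u} →ₗᵢ[ℂ] Cvec d :=
    { toLinearMap := (LinearEquiv.coord ℂ (Cvec d) u hu).toLinearMap.smulRight v
      norm_map' := fun s => by
        have := LinearEquiv.coord_apply_smul ℂ (Cvec d) u hu s
        simp only [LinearMap.smulRight_apply, norm_smul, ← h]
        rw [← norm_smul]
        exact congrArg norm this }
  refine ⟨L.extend.toLinearIsometryEquiv rfl, ?_⟩
  have h1 := L.extend_apply ⟨u, Submodule.mem_span_singleton_self u⟩
  have h2 : L ⟨u, Submodule.mem_span_singleton_self u⟩ = v := by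
    change (LinearEquiv.coord ℂ (Cvec d) u hu ⟨u, _⟩) • v = v
    rw [LinearEquiv.coord_self, one_smul]
  exact h1.trans h2

lemma exists_phase {d : ℕ} (i : Fin d) {z : ℂ} (hz : ‖z‖ = 1) :
    ∃ e : Cvec d ≃ₗᵢ[ℂ] Cvec d, ∀ φ x, e φ x = (if x = i then z else 1) * φ x := by
  let L : Cvec d →ₗᵢ[ℂ] Cvec d :=
    { toFun := fun φ => WithLp.toLp 2 fun x => (if x = i then z else 1) * φ x
      map_add' := fun φ ψ => by ext x; simp [mul_add]
      map_smul' := fun c φ => by ext x; simp [mul_left_comm]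
      norm_map' := fun φ => by
        simp only [LinearMap.coe_mk, AddHom.coe_mk, EuclideanSpace.norm_eq]
        congr 1
        refine Finset.sum_congr rfl fun x _ => ?_
        split_ifs <;> simp [hz] }
  exact ⟨L.toLinearIsometryEquiv rfl, fun φ x => rfl⟩

lemma exists_norm_one_pow_mul_star_pow_ne_one {a b : ℕ} (h : a ≠ b) :
    ∃ z : ℂ, ‖z‖ = 1 ∧ z ^ a * star (z ^ b) ≠ 1 := by
  have hab : ((a : ℂ) - b) ≠ 0 := sub_ne_zero.2 (by exact_mod_cast h)
  refine ⟨Complex.exp ((Real.pi / ((a : ℝ) - b) : ℝ) * Complex.I),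
    Complex.norm_exp_ofReal_mul_I _, ?_⟩
  rw [← Complex.exp_nat_mul, ← Complex.exp_nat_mul, Complex.star_def, ← Complex.exp_conj,
    ← Complex.exp_add]
  have : (a : ℂ) * (((Real.pi / ((a : ℝ) - b) : ℝ) : ℂ) * Complex.I) +
      (starRingEnd ℂ) ((b : ℂ) * (((Real.pi / ((a : ℝ) - b) : ℝ) : ℂ) * Complex.I)) =
      Real.pi * Complex.I := by
    simp only [map_mul, Complex.conj_I, Complex.conj_ofReal, map_natCast]
    push_cast
    field_simp
    ring
  rw [this, Complex.exp_pi_mul_I]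
  norm_num

lemma sphereMoment_of_ne {d : ℕ} {μ : Measure (USphere d)} (hμ : IsUniformOnSphere d μ)
    {α β : Fin d → ℕ} (h : α ≠ β) : sphereMoment μ α β = 0 := by
  obtain ⟨i, hi⟩ := Function.ne_iff.1 h
  obtain ⟨z, hz, hne⟩ := exists_norm_one_pow_mul_star_pow_ne_one hi
  obtain ⟨e, he⟩ := exists_phase i hz
  have hmono : ∀ (φ : USphere d) (γ : Fin d → ℕ),
      vecMonomial (sphereRot d e φ : Cvec d) γ = z ^ γ i * vecMonomial (φ : Cvec d) γ := by
    intro φ γ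
    simp only [vecMonomial, sphereRot, he, mul_pow, Finset.prod_mul_distrib, ite_pow, one_pow]
    simp
  have h1 := hμ.integral_rot e (f := fun φ : USphere d =>
    vecMonomial (φ : Cvec d) α * star (vecMonomial (φ : Cvec d) β)) (by fun_prop)
  have h2 : z ^ α i * star (z ^ β i) * sphereMoment μ α β = sphereMoment μ α β := by
    rw [sphereMoment, ← integral_const_mul, ← h1]
    refine integral_congr_ae (ae_of_all _ fun φ => ?_)
    simp only [hmono, star_mul']
    ring
  by_contra h0
  exact hne (mul_right_cancel₀ h0 (h2.trans (one_mul _).symm))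

/-- Expansion of the integral of a product of two polynomials in moments. -/
lemma integral_sum_vecMonomial {d : ℕ} {μ : Measure (USphere d)} [IsFiniteMeasure μ]
    {κ : Type*} (S : Finset κ) (c : κ → ℂ) (γ : κ → Fin d → ℕ) :
    ∫ φ : USphere d, (∑ p ∈ S, c p * vecMonomial (φ : Cvec d) (γ p)) *
        star (∑ p ∈ S, c p * vecMonomial (φ : Cvec d) (γ p)) ∂μ =
      ∑ p ∈ S, ∑ q ∈ S, c p * star (c q) * sphereMoment μ (γ p) (γ q) := by
  simp only [star_sum, Finset.sum_mul_sum]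
  rw [integral_finsetSum _ fun p _ => integrable_sphere (by fun_prop)]
  refine Finset.sum_congr rfl fun p _ => ?_
  rw [integral_finsetSum _ fun q _ => integrable_sphere (by fun_prop)]
  refine Finset.sum_congr rfl fun q _ => ?_
  rw [sphereMoment, ← integral_const_mul]
  refine integral_congr_ae (ae_of_all _ fun φ => ?_)
  simp only [star_mul']
  ring

lemma coeff_eq_of_forall_pos {d : ℕ} (S : Finset (Fin d → ℕ)) (a b : (Fin d → ℕ) → ℂ)
    (h : ∀ y : Fin d → ℝ, (∀ x, 0 < y x) →
      ∑ α ∈ S, a α * ∏ x, (y x : ℂ) ^ α x = ∑ α ∈ S, b α * ∏ x, (y x : ℂ) ^ α x) :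
    ∀ α ∈ S, a α = b α := by
  classical
  let P : ((Fin d → ℕ) → ℂ) → MvPolynomial (Fin d) ℂ := fun a =>
    ∑ α ∈ S, MvPolynomial.monomial (Finsupp.equivFunOnFinite.symm α) (a α)
  have hcoeff : ∀ (a : (Fin d → ℕ) → ℂ), ∀ α ∈ S,
      (P a).coeff (Finsupp.equivFunOnFinite.symm α) = a α := by
    intro a α hα
    simp only [P, MvPolynomial.coeff_sum, MvPolynomial.coeff_monomial,
      EmbeddingLike.apply_eq_iff_eq]
    simp [hα]
  have heval : ∀ (a : (Fin d → ℕ) → ℂ) (y : Fin d → ℂ),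
      MvPolynomial.eval y (P a) = ∑ α ∈ S, a α * ∏ x, y x ^ α x := by
    intro a y
    simp only [P, map_sum, MvPolynomial.eval_monomial]
    refine Finset.sum_congr rfl fun α _ => ?_
    rw [Finsupp.prod_fintype _ _ fun _ => pow_zero _]
    simp
  have hP : P a = P b := by
    refine MvPolynomial.funext_set (fun _ => Complex.ofReal '' Set.Ioi 0)
      (fun _ => (Set.Ioi_infinite 0).image Complex.ofReal_injective.injOn) fun z hz => ?_
    simp only [Set.mem_pi, Set.mem_univ, forall_const, Set.mem_image, Set.mem_Ioi] at hz
    choose y hy hyz using hz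
    obtain rfl : (fun x => (y x : ℂ)) = z := funext hyz
    rw [heval, heval]
    exact h y hy
  intro α hα
  rw [← hcoeff a α hα, ← hcoeff b α hα, hP]

lemma exists_sphereMoment_self {d : ℕ} (hd : 1 ≤ d) {μ : Measure (USphere d)}
    (hμ : IsUniformOnSphere d μ) (n : ℕ) :
    ∃ c : ℂ, ∀ α : Fin d → ℕ, ∑ x, α x = n →
      sphereMoment μ α α = c * (∏ x, (α x).factorial : ℕ) := by
  have := hμ.1
  let i₀ : Fin d := ⟨0, hd⟩
  let C : ℂ := ∫ φ : USphere d, (φ : Cvec d) i₀ ^ n * star ((φ : Cvec d) i₀ ^ n) ∂μ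
  have key : ∀ y : Fin d → ℝ, (∀ x, 0 < y x) →
      ∑ α ∈ Finset.piAntidiag Finset.univ n,
        ((Nat.multinomial Finset.univ α : ℂ) ^ 2 * sphereMoment μ α α) *
          ∏ x, (y x : ℂ) ^ α x =
      ∑ α ∈ Finset.piAntidiag Finset.univ n,
        (Nat.multinomial Finset.univ α * C) * ∏ x, (y x : ℂ) ^ α x := by
    intro y hy
    let ψ : Cvec d := WithLp.toLp 2 fun x => ((Real.sqrt (y x) : ℝ) : ℂ)
    have hψ : ‖ψ‖ ^ 2 = ∑ x, y x := by
      rw [EuclideanSpace.norm_sq_eq]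
      refine Finset.sum_congr rfl fun x _ => ?_
      simp [ψ, Real.sq_sqrt (hy x).le]
    have hinner : ∀ φ : Cvec d, inner ℂ ψ φ = ∑ x, ((Real.sqrt (y x) : ℝ) : ℂ) * φ x := by
      intro φ
      rw [PiLp.inner_apply]
      refine Finset.sum_congr rfl fun x _ => ?_
      simp [ψ, mul_comm]
    obtain ⟨e, he⟩ := exists_linearIsometryEquiv_apply_eq
      (u := EuclideanSpace.single i₀ (‖ψ‖ : ℂ)) (v := ψ) (by simp)
    have hrot := hμ.integral_rot e (f := fun φ : USphere d =>
      (inner ℂ ψ (φ : Cvec d)) ^ n * star ((inner ℂ ψ (φ : Cvec d)) ^ n)) (by fun_prop)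
    have hL : ∫ φ : USphere d, (inner ℂ ψ (sphereRot d e φ : Cvec d)) ^ n *
        star ((inner ℂ ψ (sphereRot d e φ : Cvec d)) ^ n) ∂μ = (∑ x, (y x : ℂ)) ^ n * C := by
      rw [← integral_const_mul]
      refine integral_congr_ae (ae_of_all _ fun φ => ?_)
      have h1 : inner ℂ ψ (sphereRot d e φ : Cvec d) = (‖ψ‖ : ℂ) * (φ : Cvec d) i₀ := by
        change inner ℂ ψ (e φ) = _
        rw [← he, e.inner_map_map, EuclideanSpace.inner_single_left]
        simp
      have h2 : (∑ x, (y x : ℂ)) = (‖ψ‖ : ℂ) ^ 2 := by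
        exact_mod_cast congrArg Complex.ofReal hψ.symm
      simp only [h1, h2, mul_pow, star_mul', star_pow, Complex.star_def, Complex.conj_ofReal]
      ring
    have hR : ∫ φ : USphere d, (inner ℂ ψ (φ : Cvec d)) ^ n *
        star ((inner ℂ ψ (φ : Cvec d)) ^ n) ∂μ = ∑ α ∈ Finset.piAntidiag Finset.univ n,
        ((Nat.multinomial Finset.univ α : ℂ) ^ 2 * sphereMoment μ α α) *
          ∏ x, (y x : ℂ) ^ α x := by
      have h1 : ∀ φ : Cvec d, inner ℂ ψ φ ^ n = ∑ α ∈ Finset.piAntidiag Finset.univ n,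
          (Nat.multinomial Finset.univ α * ∏ x, ((Real.sqrt (y x) : ℝ) : ℂ) ^ α x) *
            vecMonomial φ α := by
        intro φ
        rw [hinner, Finset.sum_pow_eq_sum_piAntidiag]
        refine Finset.sum_congr rfl fun α _ => ?_
        simp only [vecMonomial, mul_pow, Finset.prod_mul_distrib]
        ring
      simp_rw [h1]
      rw [integral_sum_vecMonomial]
      refine Finset.sum_congr rfl fun α hα => ?_
      rw [Finset.sum_eq_single α (fun β _ hβ => by
        rw [sphereMoment_of_ne hμ (Ne.symm hβ), mul_zero]) (fun h => absurd hα h)]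
      have h2 : ∏ x, (y x : ℂ) ^ α x = (∏ x, ((Real.sqrt (y x) : ℝ) : ℂ) ^ α x) ^ 2 := by
        rw [← Finset.prod_pow]
        refine Finset.prod_congr rfl fun x _ => ?_
        rw [← pow_mul, mul_comm, pow_mul, ← Complex.ofReal_pow (√(y x)), Real.sq_sqrt (hy x).le]
      rw [h2]
      simp only [star_mul', star_prod, star_pow, Complex.star_def, Complex.conj_ofReal, map_natCast]
      ring
    rw [← hR, ← hrot, hL, Finset.sum_pow_eq_sum_piAntidiag, Finset.sum_mul]
    exact Finset.sum_congr rfl fun α _ => by ring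
  refine ⟨C / n.factorial, fun α hα => ?_⟩
  have h := coeff_eq_of_forall_pos _ _ _ key α (by simp [Finset.mem_piAntidiag, hα])
  have hm : (Nat.multinomial Finset.univ α : ℂ) ≠ 0 := by
    exact_mod_cast (Nat.multinomial_pos _ _).ne'
  have hspec := Nat.multinomial_spec Finset.univ α
  rw [hα] at hspec
  rw [← hspec]
  have hf : ((∏ x, (α x).factorial : ℕ) : ℂ) ≠ 0 := by
    exact_mod_cast Finset.prod_ne_zero_iff.2 fun x _ => (α x).factorial_ne_zero
  rw [Nat.cast_mul]
  field_simp
  refine mul_left_cancel₀ hm ?_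
  rw [← h]
  ring

lemma sphereMoment_eq_sum_single {d : ℕ} {μ : Measure (USphere d)} [IsFiniteMeasure μ]
    (α : Fin d → ℕ) :
    sphereMoment μ α α = ∑ x, sphereMoment μ (α + Pi.single x 1) (α + Pi.single x 1) := by
  unfold sphereMoment
  rw [← integral_finsetSum _ fun x _ => integrable_sphere (by fun_prop)]
  refine integral_congr_ae (ae_of_all _ fun φ => ?_)
  have hsingle : ∀ x, vecMonomial (φ : Cvec d) (α + Pi.single x 1) =
      vecMonomial (φ : Cvec d) α * (φ : Cvec d) x := by
    intro x
    simp only [vecMonomial, Pi.add_apply, pow_add, Finset.prod_mul_distrib]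
    congr 1
    rw [Finset.prod_eq_single x] <;> simp +contextual
  have hnorm : ∑ x, (φ : Cvec d) x * star ((φ : Cvec d) x) = 1 := by
    have h := EuclideanSpace.norm_sq_eq (φ : Cvec d)
    rw [mem_sphere_zero_iff_norm.mp φ.2, one_pow] at h
    simp_rw [Complex.star_def, Complex.mul_conj, Complex.normSq_eq_norm_sq]
    exact_mod_cast h.symm
  simp only [hsingle, star_mul']
  calc _ = vecMonomial (φ : Cvec d) α * star (vecMonomial (φ : Cvec d) α) *
        ∑ x, (φ : Cvec d) x * star ((φ : Cvec d) x) := by rw [hnorm, mul_one]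
    _ = _ := by
      rw [Finset.mul_sum]
      exact Finset.sum_congr rfl fun x _ => by ring

lemma ascFactorial_mul_sphereMoment_self {d : ℕ} (hd : 1 ≤ d) {μ : Measure (USphere d)}
    (hμ : IsUniformOnSphere d μ) (α : Fin d → ℕ) :
    (d.ascFactorial (∑ x, α x) : ℂ) * sphereMoment μ α α = (∏ x, (α x).factorial : ℕ) := by
  have := hμ.1
  suffices H : ∀ n, ∀ α : Fin d → ℕ, ∑ x, α x = n →
      (d.ascFactorial n : ℂ) * sphereMoment μ α α = (∏ x, (α x).factorial : ℕ) from H _ α rfl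
  intro n
  induction n with
  | zero =>
    intro α hα
    have h0 : α = 0 := by
      ext x
      simpa using (Finset.sum_eq_zero_iff.1 hα) x (Finset.mem_univ x)
    subst h0
    simp [sphereMoment, vecMonomial]
  | succ n ih =>
    obtain ⟨c, hc⟩ := exists_sphereMoment_self hd hμ (n + 1)
    let γ : Fin d → ℕ := Pi.single ⟨0, hd⟩ n
    have hγ : ∑ x, γ x = n := by simp [γ]
    have h1 := ih γ hγ
    have hfac : ∀ x, (∏ y, ((γ + Pi.single x 1 : Fin d → ℕ) y).factorial) =
        (γ x + 1) * ∏ y, (γ y).factorial := by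
      intro x
      rw [← Finset.mul_prod_erase _ _ (Finset.mem_univ x),
        ← Finset.mul_prod_erase _ (fun y => (γ y).factorial) (Finset.mem_univ x), ← mul_assoc]
      congr 1
      · simp [Nat.factorial_succ]
      · refine Finset.prod_congr rfl fun y hy => ?_
        simp [Finset.ne_of_mem_erase hy]
    rw [sphereMoment_eq_sum_single] at h1
    have hsum : ∀ x, ∑ y, (γ + Pi.single x 1 : Fin d → ℕ) y = n + 1 := by
      intro x
      simp [Finset.sum_add_distrib, hγ]
    simp_rw [fun x => hc _ (hsum x), hfac] at h1
    have hpos : ((∏ y, (γ y).factorial : ℕ) : ℂ) ≠ 0 := by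
      exact_mod_cast Finset.prod_ne_zero_iff.2 fun x _ => (γ x).factorial_ne_zero
    have h2 : (d.ascFactorial (n + 1) : ℂ) * c = 1 := by
      refine mul_right_cancel₀ hpos ?_
      rw [one_mul]
      refine Eq.trans ?_ h1
      push_cast
      rw [← Finset.mul_sum, ← Finset.sum_mul, Finset.sum_add_distrib, ← Nat.cast_sum, hγ,
        Nat.ascFactorial_succ]
      push_cast
      simp
      ring
    intro α hα
    rw [hc α hα, ← mul_assoc, h2, one_mul]

/-- The one-variable coefficient in `∂^j z^a` acting (adjointly) on `z^b`, with image `z^δ`. -/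
def fischerCoeff (a b : ℕ) (e : ℕ × ℕ) : ℝ :=
  if e.1 ≤ a ∧ e.2 + a = b + e.1 then (a.factorial * b.factorial : ℝ) / (a - e.1).factorial else 0

lemma factorial_add_eq_sum_choose {a b a' b' : ℕ} (h : a' + b = a + b') :
    ((a' + b).factorial : ℝ) = ∑ j ∈ Finset.range (a + 1),
      (a.factorial * b'.factorial : ℝ) * (a'.choose j * b.choose (a - j)) := by
  have h1 : (a' + b).choose a = ∑ j ∈ Finset.range (a + 1), a'.choose j * b.choose (a - j) := by
    rw [Nat.add_choose_eq, Finset.Nat.sum_antidiagonal_eq_sum_range_succ_mk]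
  have h2 := Nat.choose_mul_factorial_mul_factorial (show a ≤ a + b' by omega)
  rw [← h, h1, h, Nat.add_sub_cancel_left] at h2
  rw [h]
  rw [← Finset.mul_sum, ← h2]
  push_cast
  ring

lemma sum_fischerCoeff (N a b a' b' : ℕ) (ha : a ≤ N) (hb : b ≤ N) :
    ∑ e ∈ Finset.range (N + 1) ×ˢ Finset.range (N + 1),
      ((e.1.factorial * e.2.factorial : ℝ))⁻¹ * fischerCoeff a b e * fischerCoeff a' b' e =
    if a' + b = a + b' then ((a' + b).factorial : ℝ) else 0 := by
  split_ifs with h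
  · rw [factorial_add_eq_sum_choose h, Finset.sum_product]
    have hsub : Finset.range (a + 1) ⊆ Finset.range (N + 1) := by
      apply Finset.range_subset_range.2; omega
    rw [← Finset.sum_subset hsub]
    · refine Finset.sum_congr rfl fun j hj => ?_
      have hja : j ≤ a := by simpa [Nat.lt_succ_iff] using hj
      by_cases hj' : j ≤ a' ∧ a ≤ b + j
      · obtain ⟨h1, h2⟩ := hj'
        rw [Finset.sum_eq_single (b + j - a)]
        · have e1 : b + j - a + a = b + j := by omega
          have e2 : b + j - a + a' = b' + j := by omega
          have e3 : b - (a - j) = b + j - a := by omega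
          simp only [fischerCoeff, hja, h1, e1, e2, and_self, if_true]
          rw [Nat.cast_choose ℝ h1, Nat.cast_choose ℝ (show a - j ≤ b by omega), e3]
          field_simp
        · intro δ _ hδ
          have : ¬ (δ + a = b + j) := by omega
          simp [fischerCoeff, this]
        · intro hn
          simp only [Finset.mem_range] at hn
          omega
      · rw [Finset.sum_eq_zero]
        · rcases not_and_or.1 hj' with h1 | h1
          · simp [Nat.choose_eq_zero_of_lt (not_le.1 h1)]
          · rw [Nat.choose_eq_zero_of_lt (show b < a - j by omega)]
            simp
        · intro δ _
          rcases not_and_or.1 hj' with h1 | h1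
          · simp [fischerCoeff, h1]
          · have : ¬ (δ + a = b + j) := by omega
            simp [fischerCoeff, this]
    · intro j _ hj
      have hja : ¬ j ≤ a := by simpa [Nat.lt_succ_iff] using hj
      exact Finset.sum_eq_zero fun δ _ => by simp [fischerCoeff, hja]
  · refine Finset.sum_eq_zero fun e _ => ?_
    by_cases h1 : e.2 + a = b + e.1
    · have : ¬ (e.2 + a' = b' + e.1) := by omega
      simp [fischerCoeff, this]
    · simp [fischerCoeff, h1]

lemma prod_factorial_ite_eq_sum {ι : Type*} [Fintype ι] [DecidableEq ι] (N : ℕ)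
    (α β α' β' : ι → ℕ) (hα : ∀ x, α x ≤ N) (hβ : ∀ x, β x ≤ N) :
    (if α' + β = α + β' then ((∏ x, (α' x + β x).factorial : ℕ) : ℝ) else 0) =
    ∑ e ∈ Fintype.piFinset fun _ : ι => Finset.range (N + 1) ×ˢ Finset.range (N + 1),
      (∏ x, (((e x).1.factorial * (e x).2.factorial : ℝ))⁻¹) *
        (∏ x, fischerCoeff (α x) (β x) (e x)) * ∏ x, fischerCoeff (α' x) (β' x) (e x) := by
  simp_rw [← Finset.prod_mul_distrib]
  rw [← Finset.prod_univ_sum (fun _ : ι => Finset.range (N + 1) ×ˢ Finset.range (N + 1))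
    (fun x e => ((e.1.factorial * e.2.factorial : ℝ))⁻¹ * fischerCoeff (α x) (β x) e *
      fischerCoeff (α' x) (β' x) e)]
  simp_rw [fun x => sum_fischerCoeff N (α x) (β x) (α' x) (β' x) (hα x) (hβ x)]
  split_ifs with h
  · push_cast
    refine Finset.prod_congr rfl fun x _ => ?_
    have := congrFun h x
    simp only [Pi.add_apply] at this
    rw [if_pos this]
  · obtain ⟨x, hx⟩ := Function.ne_iff.1 h
    exact (Finset.prod_eq_zero (Finset.mem_univ x) (if_neg hx)).symm

lemma sum_product_exchange {ι κ R : Type*} [AddCommMonoid R] (S : Finset ι) (T : Finset κ)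
    (f : ι → κ → ι → κ → R) :
    ∑ p ∈ S ×ˢ T, ∑ q ∈ S ×ˢ T, f p.1 p.2 q.1 q.2 =
      ∑ p ∈ S ×ˢ T, ∑ q ∈ S ×ˢ T, f q.1 p.2 p.1 q.2 := by
  simp only [Finset.sum_product]
  simp_rw [Finset.sum_comm (s := T) (t := S)]
  exact Finset.sum_comm

/-- **Bombieri's inequality** in coefficient form. -/
lemma bombieri_inequality {ι : Type*} [Fintype ι] [DecidableEq ι] (S T : Finset (ι → ℕ))
    (hS : ∀ α ∈ S, ∀ j ∈ S, j ≤ α → α = j) (a b : (ι → ℕ) → ℂ) :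
    (∑ α ∈ S, ((∏ x, (α x).factorial : ℕ) : ℝ) * ‖a α‖ ^ 2) *
      (∑ β ∈ T, ((∏ x, (β x).factorial : ℕ) : ℝ) * ‖b β‖ ^ 2) ≤
    (∑ p ∈ S ×ˢ T, ∑ q ∈ S ×ˢ T, (a p.1 * b p.2) * star (a q.1 * b q.2) *
      (if p.1 + p.2 = q.1 + q.2 then
        ((∏ x, (p.1 x + p.2 x).factorial : ℕ) : ℂ) else 0)).re := by
  obtain ⟨N, hN⟩ : ∃ N, ∀ α ∈ S ∪ T, ∀ x, α x ≤ N := by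
    refine ⟨∑ α ∈ S ∪ T, ∑ x, α x, fun α hα x => ?_⟩
    exact (Finset.single_le_sum (f := α) (fun _ _ => Nat.zero_le _) (Finset.mem_univ x)).trans
      (Finset.single_le_sum (f := fun α : ι → ℕ => ∑ x, α x) (fun _ _ => Nat.zero_le _) hα)
  have hNS : ∀ α ∈ S, ∀ x, α x ≤ N := fun α h => hN α (Finset.mem_union_left _ h)
  have hNT : ∀ α ∈ T, ∀ x, α x ≤ N := fun α h => hN α (Finset.mem_union_right _ h)
  set E := Fintype.piFinset fun _ : ι => Finset.range (N + 1) ×ˢ Finset.range (N + 1) with hE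
  set W : (ι → ℕ × ℕ) → ℝ := fun e => ∏ x, (((e x).1.factorial * (e x).2.factorial : ℝ))⁻¹
  set G : (ι → ℕ) → (ι → ℕ) → (ι → ℕ × ℕ) → ℝ :=
    fun α β e => ∏ x, fischerCoeff (α x) (β x) (e x) with hG
  set F : (ι → ℕ × ℕ) → ℂ := fun e => ∑ p ∈ S ×ˢ T, star (a p.1) * b p.2 * (G p.1 p.2 e : ℂ)
    with hF
  have key : (∑ p ∈ S ×ˢ T, ∑ q ∈ S ×ˢ T, (a p.1 * b p.2) * star (a q.1 * b q.2) *
      (if p.1 + p.2 = q.1 + q.2 then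
        ((∏ x, (p.1 x + p.2 x).factorial : ℕ) : ℂ) else 0)) =
      ((∑ e ∈ E, W e * ‖F e‖ ^ 2 : ℝ) : ℂ) := by
    have h1 : ∀ e, ((W e * ‖F e‖ ^ 2 : ℝ) : ℂ) = ∑ p ∈ S ×ˢ T, ∑ q ∈ S ×ˢ T,
        (star (a p.1) * b p.2) * (a q.1 * star (b q.2)) *
          ((W e * G p.1 p.2 e * G q.1 q.2 e : ℝ) : ℂ) := by
      intro e
      have : ((‖F e‖ ^ 2 : ℝ) : ℂ) = F e * star (F e) := by
        rw [Complex.star_def, Complex.mul_conj, Complex.normSq_eq_norm_sq]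
      rw [Complex.ofReal_mul, this, hF, star_sum, Finset.sum_mul_sum]
      simp only [Finset.mul_sum]
      refine Finset.sum_congr rfl fun p _ => Finset.sum_congr rfl fun q _ => ?_
      simp only [star_mul', star_star]
      rw [Complex.star_def, Complex.conj_ofReal]
      push_cast
      ring
    rw [Complex.ofReal_sum]
    simp_rw [h1]
    rw [sum_product_exchange S T (fun α β α' β' => a α * b β * star (a α' * b β') *
      (if α + β = α' + β' then ((∏ x, (α x + β x).factorial : ℕ) : ℂ) else 0))]
    refine Eq.trans (Finset.sum_congr rfl fun p hp => ?_) Finset.sum_comm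
    refine Eq.trans (Finset.sum_congr rfl fun q _ => ?_) Finset.sum_comm
    have hp' := Finset.mem_product.1 hp
    rw [← Finset.mul_sum, ← Complex.ofReal_sum,
      ← prod_factorial_ite_eq_sum N p.1 p.2 q.1 q.2 (hNS _ hp'.1) (hNT _ hp'.2)]
    simp only [star_mul']
    split_ifs <;> push_cast <;> ring
  rw [key, Complex.ofReal_re, Finset.sum_mul_sum, ← Finset.sum_product']
  have hinj : Set.InjOn (fun p : (ι → ℕ) × (ι → ℕ) => fun x => (p.1 x, p.2 x))
      (S ×ˢ T : Finset _) := by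
    intro p _ q _ h
    ext x
    · exact congrArg Prod.fst (congrFun h x)
    · exact congrArg Prod.snd (congrFun h x)
  have hsub : (S ×ˢ T).image (fun p x => (p.1 x, p.2 x)) ⊆ E := by
    intro e he
    obtain ⟨p, hp, rfl⟩ := Finset.mem_image.1 he
    rw [Finset.mem_product] at hp
    simp only [hE, Fintype.mem_piFinset, Finset.mem_product, Finset.mem_range, Nat.lt_succ_iff]
    exact fun x => ⟨hNS _ hp.1 x, hNT _ hp.2 x⟩
  have hWpos : ∀ e, 0 < W e := fun e => Finset.prod_pos fun x _ => by positivity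
  refine le_trans (le_of_eq ?_) (Finset.sum_le_sum_of_subset_of_nonneg hsub
    fun e _ _ => mul_nonneg (hWpos e).le (sq_nonneg _))
  rw [Finset.sum_image hinj]
  refine Finset.sum_congr rfl fun p hp => ?_
  have hp' := Finset.mem_product.1 hp
  have hFp : F (fun x => (p.1 x, p.2 x)) = star (a p.1) * b p.2 *
      ((∏ x, ((p.1 x).factorial * (p.2 x).factorial : ℝ) : ℝ) : ℂ) := by
    rw [hF]
    simp only
    rw [Finset.sum_eq_single p]
    · congr 2
      refine Finset.prod_congr rfl fun x _ => ?_
      simp [fischerCoeff, add_comm]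
    · intro q hq hqp
      have hq' := Finset.mem_product.1 hq
      have : G q.1 q.2 (fun x => (p.1 x, p.2 x)) = 0 := by
        by_contra hne
        have hall : ∀ x, p.1 x ≤ q.1 x ∧ p.2 x + q.1 x = q.2 x + p.1 x := by
          intro x
          by_contra hx
          exact hne (Finset.prod_eq_zero (Finset.mem_univ x) (by simp only [fischerCoeff, if_neg hx]))
        have h1 : q.1 = p.1 := hS _ hq'.1 _ hp'.1 fun x => (hall x).1
        apply hqp
        refine Prod.ext h1 (funext fun x => ?_)
        have := (hall x).2
        rw [h1] at this
        omega
      simp [this]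
    · exact fun h => absurd hp h
  rw [hFp]
  simp only [norm_mul, norm_star, Complex.norm_real, W]
  rw [Real.norm_of_nonneg (Finset.prod_nonneg fun x _ => by positivity)]
  rw [Finset.prod_inv_distrib]
  have hne : (∏ x, ((p.1 x).factorial * (p.2 x).factorial : ℝ)) ≠ 0 :=
    Finset.prod_ne_zero_iff.2 fun x _ => by positivity
  have : ((∏ x, (p.1 x).factorial : ℕ) : ℝ) * ((∏ x, (p.2 x).factorial : ℕ) : ℝ) =
      ∏ x, ((p.1 x).factorial * (p.2 x).factorial : ℝ) := by
    push_cast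
    rw [Finset.prod_mul_distrib]
  field_simp
  rw [← this]
  ring

/-- The number of occurrences of each basis index in a multi-index `i`. -/
def occ {d k : ℕ} (i : Fin k → Fin d) : Fin d → ℕ := fun x => Fintype.card {a // i a = x}

lemma sum_occ {d k : ℕ} (i : Fin k → Fin d) : ∑ x, occ i x = k := by
  simp only [occ, Fintype.card_subtype]
  rw [← Finset.card_eq_sum_card_fiberwise (fun _ _ => Finset.mem_univ _)]
  simp

lemma occ_mem_piAntidiag {d k : ℕ} (i : Fin k → Fin d) :
    occ i ∈ Finset.piAntidiag Finset.univ k := by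
  simp [Finset.mem_piAntidiag, sum_occ]

lemma prod_apply_eq_vecMonomial {d k : ℕ} (φ : Cvec d) (i : Fin k → Fin d) :
    ∏ a, φ (i a) = vecMonomial φ (occ i) := by
  rw [← Finset.prod_fiberwise Finset.univ i, vecMonomial]
  refine Finset.prod_congr rfl fun x _ => ?_
  rw [Finset.prod_congr rfl (g := fun _ => φ x) fun a ha => by simp_all]
  simp [occ, Fintype.card_subtype]

lemma occ_comp_perm {d k : ℕ} (j : Fin k → Fin d) (π : Equiv.Perm (Fin k)) :
    occ (j ∘ π) = occ j := by
  ext x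
  exact Fintype.card_congr (π.subtypeEquiv fun a => Iff.rfl)

lemma exists_perm_of_occ_eq {d k : ℕ} {i j : Fin k → Fin d} (h : occ i = occ j) :
    ∃ π : Equiv.Perm (Fin k), i = j ∘ π := by
  have e : ∀ x, {a // i a = x} ≃ {a // j a = x} := fun x =>
    Fintype.equivOfCardEq (congrFun h x)
  exact ⟨Equiv.ofFiberEquiv e, funext fun a => (Equiv.ofFiberEquiv_map e a).symm⟩

lemma PsymM_apply {d k : ℕ} (i j : Fin k → Fin d) :
    PsymM d k i j = (k.factorial : ℂ)⁻¹ *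
      if occ i = occ j then ((∏ x, (occ i x).factorial : ℕ) : ℂ) else 0 := by
  simp only [PsymM, Matrix.smul_apply, Matrix.sum_apply, permMat, smul_eq_mul, Finset.sum_boole]
  congr 1
  split_ifs with h
  · obtain ⟨π₀, rfl⟩ := exists_perm_of_occ_eq h
    rw [occ_comp_perm]
    have := DomMulAct.stabilizer_card j
    simp only [occ]
    rw [← this, ← Fintype.card_subtype]
    congr 1
    refine Fintype.card_congr ((Equiv.mulRight π₀⁻¹).subtypeEquiv fun π => ?_)
    simp only [Equiv.coe_mulRight, Equiv.Perm.coe_mul, ← Function.comp_assoc]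
    constructor
    · intro h
      rw [← h, Function.comp_assoc, ← Equiv.Perm.coe_mul]
      simp
    · intro h
      conv_lhs => rw [← h]
      rw [Function.comp_assoc, ← Equiv.Perm.coe_mul]
      simp
  · rw [Finset.filter_false_of_mem, Finset.card_empty, Nat.cast_zero]
    rintro π - rfl
    exact h (occ_comp_perm j π)

/-- The coefficient of `φ^α` in the polynomial `∑ i, u i * ∏ a, φ (i a)`. -/
def symCoeff {d k : ℕ} (u : (Fin k → Fin d) → ℂ) (α : Fin d → ℕ) : ℂ :=
  ∑ i with occ i = α, u i

/-- The homogeneous polynomial with coefficient tensor `u`. -/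
def tensorPoly {d k : ℕ} (u : (Fin k → Fin d) → ℂ) (φ : Cvec d) : ℂ :=
  ∑ i, u i * ∏ a, φ (i a)

/-- The Bombieri norm squared of `tensorPoly u`, i.e. `⟨u, P_sym u⟩`. -/
def bombieriSq {d k : ℕ} (u : (Fin k → Fin d) → ℂ) : ℝ :=
  (k.factorial : ℝ)⁻¹ * ∑ α ∈ Finset.piAntidiag Finset.univ k,
    ((∏ x, (α x).factorial : ℕ) : ℝ) * ‖symCoeff u α‖ ^ 2

lemma bombieriSq_nonneg {d k : ℕ} (u : (Fin k → Fin d) → ℂ) : 0 ≤ bombieriSq u := by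
  unfold bombieriSq
  positivity

lemma bombieriSq_star {d k : ℕ} (u : (Fin k → Fin d) → ℂ) :
    bombieriSq (star u) = bombieriSq u := by
  have : ∀ α, symCoeff (star u) α = star (symCoeff u α) := fun α => by
    simp [symCoeff]
  simp only [bombieriSq, this, norm_star]

lemma tensorPoly_eq {d k : ℕ} (u : (Fin k → Fin d) → ℂ) (φ : Cvec d) :
    tensorPoly u φ = ∑ α ∈ Finset.piAntidiag Finset.univ k, symCoeff u α * vecMonomial φ α := by
  rw [tensorPoly, ← Finset.sum_fiberwise_of_maps_to (fun i _ => occ_mem_piAntidiag i)]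
  refine Finset.sum_congr rfl fun α _ => ?_
  rw [symCoeff, Finset.sum_mul]
  refine Finset.sum_congr rfl fun i hi => ?_
  rw [prod_apply_eq_vecMonomial, (Finset.mem_filter.1 hi).2]

@[fun_prop]
lemma continuous_tensorPoly {d k : ℕ} (u : (Fin k → Fin d) → ℂ) :
    Continuous fun φ : USphere d => tensorPoly u (φ : Cvec d) := by
  unfold tensorPoly
  fun_prop

lemma sum_PsymM_eq_bombieriSq {d k : ℕ} (u : (Fin k → Fin d) → ℂ) :
    ∑ i, ∑ j, star (u i) * PsymM d k i j * u j = (bombieriSq u : ℂ) := by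
  have h1 : ∀ α : Fin d → ℕ, ((‖symCoeff u α‖ ^ 2 : ℝ) : ℂ) =
      ∑ i with occ i = α, ∑ j with occ j = α, star (u i) * u j := by
    intro α
    rw [← Complex.normSq_eq_norm_sq, ← Complex.mul_conj, mul_comm, ← Complex.star_def, symCoeff,
      star_sum, Finset.sum_mul_sum]
  rw [bombieriSq]
  push_cast
  rw [Finset.mul_sum, ← Finset.sum_fiberwise_of_maps_to (fun i _ => occ_mem_piAntidiag i)]
  refine Finset.sum_congr rfl fun α _ => ?_
  rw [← Complex.ofReal_pow, h1, Finset.mul_sum, Finset.mul_sum]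
  refine Finset.sum_congr rfl fun i hi => ?_
  obtain rfl := (Finset.mem_filter.1 hi).2
  rw [Finset.mul_sum, Finset.mul_sum, Finset.sum_filter]
  refine Finset.sum_congr rfl fun j _ => ?_
  rw [PsymM_apply]
  by_cases h : occ i = occ j
  · simp only [h, if_true]
    push_cast
    ring
  · simp [h, Ne.symm h]

lemma bombieriSq_mul_le_integral {d k : ℕ} (hd : 1 ≤ d) {μ : Measure (USphere d)}
    (hμ : IsUniformOnSphere d μ) (u v : (Fin k → Fin d) → ℂ) :
    (k.factorial : ℝ) ^ 2 * (bombieriSq u * bombieriSq v) ≤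
      d.ascFactorial (k + k) *
        ∫ φ : USphere d, ‖tensorPoly u (φ : Cvec d)‖ ^ 2 * ‖tensorPoly v (φ : Cvec d)‖ ^ 2 ∂μ := by
  have := hμ.1
  set S : Finset (Fin d → ℕ) := Finset.piAntidiag Finset.univ k with hS
  have hsum : ∀ α ∈ S, ∑ x, α x = k := fun α hα => by
    simpa using (Finset.mem_piAntidiag.1 hα).1
  have hanti : ∀ α ∈ S, ∀ j ∈ S, j ≤ α → α = j := by
    intro α hα j hj hle
    ext x
    exact ((Finset.sum_eq_sum_iff_of_le fun x _ => hle x).1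
      ((hsum j hj).trans (hsum α hα).symm) x (Finset.mem_univ x)).symm
  have hasc : (d.ascFactorial (k + k) : ℝ) ≠ 0 := by
    obtain ⟨m, rfl⟩ : ∃ m, d = m + 1 := ⟨d - 1, by omega⟩
    exact_mod_cast (Nat.ascFactorial_pos m (k + k)).ne'
  have hmom : ∀ p ∈ S ×ˢ S, ∀ q ∈ S ×ˢ S,
      (d.ascFactorial (k + k) : ℂ) * sphereMoment μ (p.1 + p.2) (q.1 + q.2) =
        if p.1 + p.2 = q.1 + q.2 then ((∏ x, (p.1 x + p.2 x).factorial : ℕ) : ℂ) else 0 := by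
    intro p hp q _
    split_ifs with h
    · have hp' := Finset.mem_product.1 hp
      have := ascFactorial_mul_sphereMoment_self hd hμ (p.1 + p.2)
      simp only [Pi.add_apply, Finset.sum_add_distrib, hsum _ hp'.1, hsum _ hp'.2] at this
      rw [← h, this]
    · rw [sphereMoment_of_ne hμ h, mul_zero]
  have hint : ((d.ascFactorial (k + k) * ∫ φ : USphere d, ‖tensorPoly u (φ : Cvec d)‖ ^ 2 *
        ‖tensorPoly v (φ : Cvec d)‖ ^ 2 ∂μ : ℝ) : ℂ) =
      ∑ p ∈ S ×ˢ S, ∑ q ∈ S ×ˢ S, (symCoeff u p.1 * symCoeff v p.2) *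
        star (symCoeff u q.1 * symCoeff v q.2) *
        (if p.1 + p.2 = q.1 + q.2 then
          ((∏ x, (p.1 x + p.2 x).factorial : ℕ) : ℂ) else 0) := by
    have hprod : ∀ φ : USphere d, ((‖tensorPoly u (φ : Cvec d)‖ ^ 2 *
        ‖tensorPoly v (φ : Cvec d)‖ ^ 2 : ℝ) : ℂ) =
        (∑ p ∈ S ×ˢ S, (symCoeff u p.1 * symCoeff v p.2) *
          vecMonomial (φ : Cvec d) (p.1 + p.2)) *
        star (∑ p ∈ S ×ˢ S, (symCoeff u p.1 * symCoeff v p.2) *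
          vecMonomial (φ : Cvec d) (p.1 + p.2)) := by
      intro φ
      have : ∑ p ∈ S ×ˢ S, (symCoeff u p.1 * symCoeff v p.2) *
          vecMonomial (φ : Cvec d) (p.1 + p.2) =
          tensorPoly u (φ : Cvec d) * tensorPoly v (φ : Cvec d) := by
        rw [tensorPoly_eq, tensorPoly_eq, Finset.sum_mul_sum, ← Finset.sum_product']
        refine Finset.sum_congr rfl fun p _ => ?_
        simp only [vecMonomial, Pi.add_apply, pow_add, Finset.prod_mul_distrib]
        ring
      rw [this, Complex.star_def, Complex.mul_conj, Complex.normSq_eq_norm_sq, norm_mul, mul_pow]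
    rw [Complex.ofReal_mul, ← integral_complex_ofReal]
    simp_rw [hprod]
    rw [integral_sum_vecMonomial (S ×ˢ S)
      (fun p : (Fin d → ℕ) × (Fin d → ℕ) => symCoeff u p.1 * symCoeff v p.2)
      (fun p => p.1 + p.2), Finset.mul_sum]
    refine Finset.sum_congr rfl fun p hp => ?_
    rw [Finset.mul_sum]
    refine Finset.sum_congr rfl fun q hq => ?_
    rw [← hmom p hp q hq]
    push_cast
    ring
  have hB := bombieri_inequality S S hanti (symCoeff u) (symCoeff v)
  rw [← hint, Complex.ofReal_re] at hB
  refine le_trans (le_of_eq ?_) hB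
  have : (k.factorial : ℝ) ≠ 0 := by positivity
  simp only [bombieriSq, ← hS]
  field_simp

lemma exp_mul_ascFactorial_le {d : ℕ} (k : ℕ) (hd : 1 ≤ d) :
    Real.exp (-(k : ℝ) ^ 2 / d) * d.ascFactorial (k + k) ≤ (d.ascFactorial k : ℝ) ^ 2 := by
  have hd0 : (0 : ℝ) < d := by exact_mod_cast hd
  have h : ((d + k).ascFactorial k : ℝ) ≤ Real.exp ((k : ℝ) ^ 2 / d) * d.ascFactorial k := by
    have hexp : Real.exp ((k : ℝ) ^ 2 / d) = ∏ _i ∈ Finset.range k, Real.exp ((k : ℝ) / d) := by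
      rw [Finset.prod_const, Finset.card_range, ← Real.exp_nat_mul]
      congr 1
      ring
    rw [Nat.ascFactorial_eq_prod_range, Nat.ascFactorial_eq_prod_range, hexp]
    push_cast
    rw [← Finset.prod_mul_distrib]
    refine Finset.prod_le_prod (fun i _ => by positivity) fun i _ => ?_
    calc (d + k + i : ℝ) ≤ (k / d + 1) * (d + i) := by
          have h1 : (k / d + 1 : ℝ) * (d + i) = d + k + i + k * i / d := by
            field_simp
            ring
          rw [h1]
          have : (0 : ℝ) ≤ k * i / d := by positivity
          linarith
      _ ≤ _ := by
          gcongr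
          exact Real.add_one_le_exp _
  rw [← Nat.ascFactorial_mul_ascFactorial, neg_div, Real.exp_neg]
  push_cast
  rw [inv_mul_le_iff₀ (Real.exp_pos _)]
  calc _ ≤ (d.ascFactorial k : ℝ) * (Real.exp ((k : ℝ) ^ 2 / d) * d.ascFactorial k) := by gcongr
    _ = _ := by ring

lemma posSemidef_of_forall_sum {n : Type*} [Fintype n] [DecidableEq n] {A : Matrix n n ℂ}
    (h : ∀ x : n → ℂ, ∃ r : ℝ, 0 ≤ r ∧ ∑ i, ∑ j, star (x i) * A i j * x j = r) :
    A.PosSemidef := by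
  rw [← Matrix.isPositive_toEuclideanLin_iff, LinearMap.isPositive_iff_complex]
  intro x
  obtain ⟨r, hr, hx⟩ := h x.ofLp
  have : inner ℂ (Matrix.toEuclideanLin A x) x = (r : ℂ) := by
    rw [← inner_conj_symm, EuclideanSpace.inner_eq_star_dotProduct, ← Complex.conj_ofReal, ← hx]
    congr 1
    rw [dotProduct_comm]
    simp only [dotProduct, Matrix.mulVec, Finset.mul_sum, Matrix.ofLp_toLpLin,
      Matrix.toLin'_apply, Pi.star_apply, mul_assoc]
  rw [this]
  simpa using hr

lemma exists_eq_sum_of_posSemidef {n : Type*} [Fintype n] [DecidableEq n] {M : Matrix n n ℂ}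
    (hM : M.PosSemidef) : ∃ B : n → n → ℂ, ∀ i j, M i j = ∑ r, star (B r i) * B r j := by
  open scoped MatrixOrder in
  obtain ⟨B, hB⟩ := CStarAlgebra.nonneg_iff_eq_star_mul_self.1 hM.nonneg
  refine ⟨B, fun i j => ?_⟩
  rw [hB, Matrix.mul_apply]
  rfl

lemma sum_mul_ketbraPow {d k : ℕ} (u : (Fin k → Fin d) → ℂ) (φ : Cvec d) :
    ∑ i, ∑ j, star (u i) * u j * ketbraPow d k φ j i = ((‖tensorPoly u φ‖ ^ 2 : ℝ) : ℂ) := by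
  rw [← Complex.normSq_eq_norm_sq, ← Complex.mul_conj, mul_comm, ← Complex.star_def, tensorPoly,
    star_sum, Finset.sum_mul_sum]
  refine Finset.sum_congr rfl fun i _ => Finset.sum_congr rfl fun j _ => ?_
  simp only [ketbraPow, Finset.prod_mul_distrib, star_mul', star_prod]
  ring

lemma trace_mul_eq_sum {n : Type*} [Fintype n] {M : Matrix n n ℂ} {B : n → n → ℂ}
    (hB : ∀ i j, M i j = ∑ r, star (B r i) * B r j) (K : Matrix n n ℂ) :
    (M * K).trace = ∑ r, ∑ i, ∑ j, star (B r i) * B r j * K j i := by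
  simp only [Matrix.trace, Matrix.diag, Matrix.mul_apply, hB, Finset.sum_mul]
  exact (Finset.sum_congr rfl fun i _ => Finset.sum_comm).trans Finset.sum_comm

lemma trace_mul_ketbraPow {d k : ℕ} {M : Matrix (Fin k → Fin d) (Fin k → Fin d) ℂ}
    {B : (Fin k → Fin d) → (Fin k → Fin d) → ℂ}
    (hB : ∀ i j, M i j = ∑ r, star (B r i) * B r j) (φ : Cvec d) :
    (M * ketbraPow d k φ).trace = ((∑ r, ‖tensorPoly (B r) φ‖ ^ 2 : ℝ) : ℂ) := by
  simp only [trace_mul_eq_sum hB, sum_mul_ketbraPow, Complex.ofReal_sum]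

lemma PsymM_symm {d k : ℕ} (i j : Fin k → Fin d) : PsymM d k i j = PsymM d k j i := by
  rw [PsymM_apply, PsymM_apply]
  by_cases h : occ i = occ j
  · simp [h]
  · simp [h, Ne.symm h]

lemma trace_mul_PsymM {d k : ℕ} {M : Matrix (Fin k → Fin d) (Fin k → Fin d) ℂ}
    {B : (Fin k → Fin d) → (Fin k → Fin d) → ℂ}
    (hB : ∀ i j, M i j = ∑ r, star (B r i) * B r j) :
    (M * PsymM d k).trace = ((∑ r, bombieriSq (B r) : ℝ) : ℂ) := by
  rw [trace_mul_eq_sum hB, Complex.ofReal_sum]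
  refine Finset.sum_congr rfl fun r _ => ?_
  rw [← sum_PsymM_eq_bombieriSq]
  refine Finset.sum_congr rfl fun i _ => Finset.sum_congr rfl fun j _ => ?_
  rw [PsymM_symm j i]
  ring

lemma sum_postState {d k : ℕ} {μ : Measure (USphere d)} [IsFiniteMeasure μ]
    {M : Matrix (Fin k → Fin d) (Fin k → Fin d) ℂ}
    {B : (Fin k → Fin d) → (Fin k → Fin d) → ℂ}
    (hB : ∀ i j, M i j = ∑ r, star (B r i) * B r j) (x : (Fin k → Fin d) → ℂ) :
    ∑ i, ∑ j, star (x i) * postState d k μ M i j * x j =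
      ((∑ r, ∫ φ : USphere d, ‖tensorPoly (B r) (φ : Cvec d)‖ ^ 2 *
        ‖tensorPoly (star x) (φ : Cvec d)‖ ^ 2 ∂μ : ℝ) : ℂ) := by
  have hcont : ∀ i j, Continuous fun φ : USphere d => ketbraPow d k (φ : Cvec d) i j := by
    intro i j
    unfold ketbraPow
    fun_prop
  have h1 : ∀ i j, star (x i) * postState d k μ M i j * x j =
      ∫ φ : USphere d, ((∑ r, ‖tensorPoly (B r) (φ : Cvec d)‖ ^ 2 : ℝ) : ℂ) *
        (star (x i) * x j * ketbraPow d k (φ : Cvec d) i j) ∂μ := by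
    intro i j
    rw [postState, ← integral_const_mul, ← integral_mul_const]
    refine integral_congr_ae (ae_of_all _ fun φ => ?_)
    simp only [trace_mul_ketbraPow hB]
    ring
  have hc : ∀ i j, Continuous fun φ : USphere d =>
      ((∑ r, ‖tensorPoly (B r) (φ : Cvec d)‖ ^ 2 : ℝ) : ℂ) *
        (star (x i) * x j * ketbraPow d k (φ : Cvec d) i j) := fun i j =>
    (Complex.continuous_ofReal.comp (by fun_prop)).mul (continuous_const.mul (hcont i j))
  simp_rw [h1]
  have h2 : ∀ φ : USphere d, ∑ i, ∑ j, ((∑ r, ‖tensorPoly (B r) (φ : Cvec d)‖ ^ 2 : ℝ) : ℂ) *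
      (star (x i) * x j * ketbraPow d k (φ : Cvec d) i j) =
      ∑ r, ((‖tensorPoly (B r) (φ : Cvec d)‖ ^ 2 *
        ‖tensorPoly (star x) (φ : Cvec d)‖ ^ 2 : ℝ) : ℂ) := by
    intro φ
    rw [← Complex.ofReal_sum, ← Finset.sum_mul, Complex.ofReal_mul, ← sum_mul_ketbraPow,
      Finset.sum_comm]
    simp only [← Finset.mul_sum, Pi.star_apply, star_star]
    congr 1
    refine Finset.sum_congr rfl fun i _ => Finset.sum_congr rfl fun j _ => ?_
    ring
  have h3 : ∀ i, ∑ j, ∫ φ : USphere d, ((∑ r, ‖tensorPoly (B r) (φ : Cvec d)‖ ^ 2 : ℝ) : ℂ) *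
        (star (x i) * x j * ketbraPow d k (φ : Cvec d) i j) ∂μ =
      ∫ φ : USphere d, ∑ j, ((∑ r, ‖tensorPoly (B r) (φ : Cvec d)‖ ^ 2 : ℝ) : ℂ) *
        (star (x i) * x j * ketbraPow d k (φ : Cvec d) i j) ∂μ := fun i =>
    (integral_finsetSum _ fun j _ => integrable_sphere (hc i j)).symm
  simp_rw [h3]
  rw [← integral_finsetSum _ fun i _ => integrable_sphere
    (continuous_finsetSum _ fun j _ => hc i j)]
  simp_rw [h2]
  have hr : ∀ r, Continuous fun φ : USphere d => ((‖tensorPoly (B r) (φ : Cvec d)‖ ^ 2 *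
      ‖tensorPoly (star x) (φ : Cvec d)‖ ^ 2 : ℝ) : ℂ) := fun r =>
    Complex.continuous_ofReal.comp (by fun_prop)
  rw [integral_finsetSum _ fun r _ => integrable_sphere (hr r), Complex.ofReal_sum]
  exact Finset.sum_congr rfl fun r _ => integral_complex_ofReal

lemma div_mul_sub_nonneg {E A F D τ N J : ℝ} (hA : 0 < A) (hD : 0 < D) (hτ : 0 < τ) (hN : 0 ≤ N)
    (h1 : E * A ≤ (F * D) ^ 2) (h2 : F ^ 2 * (τ * N) ≤ A * J) :
    0 ≤ D / τ * J - E * (D⁻¹ * N) := by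
  have h3 : E * N * τ ≤ D ^ 2 * J := by
    refine le_of_mul_le_mul_left ?_ hA
    calc A * (E * N * τ) = (E * A) * (τ * N) := by ring
      _ ≤ (F * D) ^ 2 * (τ * N) := by gcongr
      _ = D ^ 2 * (F ^ 2 * (τ * N)) := by ring
      _ ≤ D ^ 2 * (A * J) := by gcongr
      _ = A * (D ^ 2 * J) := by ring
  have h4 : D / τ * J - E * (D⁻¹ * N) = (D ^ 2 * J - E * N * τ) / (τ * D) := by
    field_simp
  rw [h4]
  exact div_nonneg (sub_nonneg.2 h3) (mul_pos hτ hD).le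

/-- Max-relative-entropy closeness to the maximally mixed state: for any
psd `M` with `Tr(M·P_sym) > 0`, the normalized post-measurement state
`(C(d+k-1,k)/Tr(M·P_sym)) ∫ Tr(M |φ⟩⟨φ|^{⊗k}) |φ⟩⟨φ|^{⊗k} dμ(φ)` dominates
`e^{−k²/d} · C(d+k-1,k)⁻¹ · P_sym`. -/
theorem stmt6 (d k : ℕ) (hd : 1 ≤ d) (hk : 1 ≤ k)
    (μ : Measure (USphere d)) (hμ : IsUniformOnSphere d μ)
    (M : Matrix (Fin k → Fin d) (Fin k → Fin d) ℂ) (hM : M.PosSemidef)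
    (htr : 0 < Complex.re ((M * PsymM d k).trace)) :
    (((Nat.choose (d + k - 1) k : ℂ) / (M * PsymM d k).trace) • postState d k μ M
      - ((Real.exp (-(k : ℝ) ^ 2 / d) : ℝ) : ℂ) •
          ((Nat.choose (d + k - 1) k : ℂ))⁻¹ • PsymM d k).PosSemidef := by
  have := hμ.1
  obtain ⟨B, hB⟩ := exists_eq_sum_of_posSemidef hM
  set D : ℕ := Nat.choose (d + k - 1) k with hD
  set τ : ℝ := ∑ r, bombieriSq (B r) with hτ
  have hτ0 : 0 < τ := by
    rwa [trace_mul_PsymM hB, Complex.ofReal_re] at htr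
  have hD0 : (0 : ℝ) < D := by
    exact_mod_cast Nat.choose_pos (by omega)
  refine posSemidef_of_forall_sum fun x => ?_
  set J : (Fin k → Fin d) → ℝ := fun r => ∫ φ : USphere d,
    ‖tensorPoly (B r) (φ : Cvec d)‖ ^ 2 * ‖tensorPoly (star x) (φ : Cvec d)‖ ^ 2 ∂μ
  refine ⟨D / τ * ∑ r, J r - Real.exp (-(k : ℝ) ^ 2 / d) * ((D : ℝ)⁻¹ * bombieriSq x), ?_, ?_⟩
  · have hasc : (d.ascFactorial k : ℝ) = k.factorial * D := by
      rw [hD, ← Nat.cast_mul, Nat.ascFactorial_eq_factorial_mul_choose']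
    have h1 := exp_mul_ascFactorial_le k hd
    rw [hasc] at h1
    have h2 : (k.factorial : ℝ) ^ 2 * (τ * bombieriSq x) ≤
        d.ascFactorial (k + k) * ∑ r, J r := by
      rw [hτ, Finset.sum_mul, Finset.mul_sum, Finset.mul_sum]
      refine Finset.sum_le_sum fun r _ => ?_
      rw [← bombieriSq_star x]
      exact bombieriSq_mul_le_integral hd hμ (B r) (star x)
    have hA : (0 : ℝ) < d.ascFactorial (k + k) := by
      obtain ⟨m, rfl⟩ : ∃ m, d = m + 1 := ⟨d - 1, by omega⟩
      exact_mod_cast Nat.ascFactorial_pos m (k + k)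
    exact div_mul_sub_nonneg hA hD0 hτ0 (bombieriSq_nonneg x) h1 h2
  · have hpost : ((∑ r, J r : ℝ) : ℂ) = ∑ i, ∑ j, star (x i) * postState d k μ M i j * x j :=
      (sum_postState hB x).symm
    rw [trace_mul_PsymM hB, ← hτ, Complex.ofReal_sub, Complex.ofReal_mul, Complex.ofReal_mul,
      Complex.ofReal_mul, Complex.ofReal_div, Complex.ofReal_inv, Complex.ofReal_natCast, hpost,
      ← sum_PsymM_eq_bombieriSq]
    simp only [Finset.mul_sum, ← Finset.sum_sub_distrib]
    refine Finset.sum_congr rfl fun i _ => Finset.sum_congr rfl fun j _ => ?_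
    simp only [Matrix.sub_apply, Matrix.smul_apply, smul_eq_mul]
    ring

end
end

section
/- Let d ≥ 1 and let ρ, σ be positive semidefinite d×d complex matrices with Tr ρ = Tr σ = 1. Let μ_H be the Haar probability measure on the unitary group U(d) of d×d complex matrices. Then ∫_{U(d)} Σ_{b=0}^{d-1} (UρU*)_{bb} · (UσU*)_{bb} dμ_H(U) = (1 + Tr(ρσ))/(d+1). -/
open MeasureTheory Matrix
open scoped ComplexOrder

noncomputable section

instance (d : ℕ) : MeasurableSpace (Matrix (Fin d) (Fin d) ℂ) := MeasurableSpace.pi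

/-- `μH` is the Haar probability measure on the unitary group `U(d)`:
a left-invariant probability measure. -/
def IsHaarOnUnitary (d : ℕ) (μH : Measure (Matrix.unitaryGroup (Fin d) ℂ)) : Prop :=
  IsProbabilityMeasure μH ∧
    ∀ U : Matrix.unitaryGroup (Fin d) ℂ, μH.map (fun V => U * V) = μH

/-- The unitary acting as `[[s, sω], [s, -sω]]`, `s = 1/√2`, on the coordinates `a, b`
and as the identity on all the others. -/
def planeHadamard {d : ℕ} (a b : Fin d) (ω : ℂ) : Matrix (Fin d) (Fin d) ℂ :=
  ((1 : Matrix (Fin d) (Fin d) ℂ).updateRow a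
    (((√2)⁻¹ : ℝ) • (Pi.single a 1 + Pi.single b ω))).updateRow b
    (((√2)⁻¹ : ℝ) • (Pi.single a 1 - Pi.single b ω))

section planeHadamard

variable {d : ℕ} {a b : Fin d} {ω : ℂ}

lemma planeHadamard_left (hab : a ≠ b) :
    planeHadamard a b ω a = ((√2)⁻¹ : ℝ) • (Pi.single a 1 + Pi.single b ω) := by
  simp [planeHadamard, Matrix.updateRow_ne hab]

lemma planeHadamard_right :
    planeHadamard a b ω b = ((√2)⁻¹ : ℝ) • (Pi.single a 1 - Pi.single b ω) := by
  simp [planeHadamard]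

lemma planeHadamard_of_ne {i : Fin d} (ha : i ≠ a) (hb : i ≠ b) :
    planeHadamard a b ω i = Pi.single i 1 := by
  rw [planeHadamard, Matrix.updateRow_ne hb, Matrix.updateRow_ne ha]
  ext j
  simp [Matrix.one_apply, Pi.single_apply, eq_comm]

lemma inv_sqrt_two_mul_self : (((√2)⁻¹ : ℝ) : ℂ) * (((√2)⁻¹ : ℝ) : ℂ) = 1 / 2 := by
  rw [← Complex.ofReal_mul, ← mul_inv, Real.mul_self_sqrt (by norm_num)]
  norm_num

lemma star_single {d : ℕ} (i : Fin d) (x : ℂ) :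
    star (Pi.single i x : Fin d → ℂ) = Pi.single i (star x) := by
  ext j
  by_cases h : j = i
  · subst h; simp
  · simp [h]

lemma planeHadamard_mem (hab : a ≠ b) (hω : ω * star ω = 1) :
    planeHadamard a b ω ∈ Matrix.unitaryGroup (Fin d) ℂ := by
  rw [Matrix.mem_unitaryGroup_iff]
  ext i j
  have key : (planeHadamard a b ω * star (planeHadamard a b ω)) i j =
      planeHadamard a b ω i ⬝ᵥ star (planeHadamard a b ω j) := rfl
  have hs := inv_sqrt_two_mul_self
  have hω' : ω * (starRingEnd ℂ) ω = 1 := hω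
  rw [key]
  have hrow : ∀ i, i = a ∨ i = b ∨ (i ≠ a ∧ i ≠ b) := fun i => by tauto
  have hba := hab.symm
  rcases hrow i with rfl | rfl | ⟨hia, hib⟩ <;> rcases hrow j with rfl | rfl | ⟨hja, hjb⟩ <;>
    simp only [planeHadamard_left, planeHadamard_right, planeHadamard_of_ne, ne_eq, *,
      not_false_eq_true, star_smul, star_add, star_sub, star_single,
      dotProduct_smul, dotProduct_add, dotProduct_sub, dotProduct_single, Pi.add_apply,
      Pi.sub_apply, Pi.smul_apply, Complex.real_smul, star_trivial, Pi.single_apply,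
      Matrix.one_apply, if_true, if_false, star_one, Complex.star_def]
  · linear_combination (1 + ω * (starRingEnd ℂ) ω) * hs + hω' / 2
  · linear_combination (-((((√2)⁻¹ : ℝ) : ℂ) * (((√2)⁻¹ : ℝ) : ℂ))) * hω'
  · simp [hja.symm]
  · linear_combination (-((((√2)⁻¹ : ℝ) : ℂ) * (((√2)⁻¹ : ℝ) : ℂ))) * hω'
  · linear_combination (1 + ω * (starRingEnd ℂ) ω) * hs + hω' / 2
  · simp [hjb.symm]
  · simp [hia.symm, hib.symm]
  · simp [hia.symm, hib.symm]
  · simp [eq_comm]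

lemma planeHadamard_conj_left (hab : a ≠ b) (X : Matrix (Fin d) (Fin d) ℂ) :
    (planeHadamard a b ω * X * (planeHadamard a b ω)ᴴ) a a =
      (X a a + star ω * X a b + ω * X b a + ω * star ω * X b b) / 2 := by
  have key : (planeHadamard a b ω * X * (planeHadamard a b ω)ᴴ) a a =
      (planeHadamard a b ω a ᵥ* X) ⬝ᵥ star (planeHadamard a b ω a) := rfl
  have hs := inv_sqrt_two_mul_self
  rw [key, planeHadamard_left hab]
  simp only [Matrix.smul_vecMul, Matrix.add_vecMul, star_smul, star_add,
    star_single, dotProduct_smul, dotProduct_add, dotProduct_single,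
    Complex.real_smul, star_trivial, Pi.add_apply, Pi.smul_apply,
    Matrix.single_vecMul, Matrix.row_apply, smul_eq_mul, star_one]
  linear_combination (X a a + star ω * X a b + ω * X b a + ω * star ω * X b b) * hs

lemma planeHadamard_conj_right (X : Matrix (Fin d) (Fin d) ℂ) :
    (planeHadamard a b ω * X * (planeHadamard a b ω)ᴴ) b b =
      (X a a - star ω * X a b - ω * X b a + ω * star ω * X b b) / 2 := by
  have key : (planeHadamard a b ω * X * (planeHadamard a b ω)ᴴ) b b =
      (planeHadamard a b ω b ᵥ* X) ⬝ᵥ star (planeHadamard a b ω b) := rfl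
  have hs := inv_sqrt_two_mul_self
  rw [key, planeHadamard_right]
  simp only [Matrix.smul_vecMul, Matrix.sub_vecMul, star_smul,
    star_sub, star_single, dotProduct_smul, dotProduct_sub, dotProduct_single,
    Complex.real_smul, star_trivial, Pi.sub_apply, Pi.smul_apply,
    Matrix.single_vecMul, Matrix.row_apply, smul_eq_mul, star_one]
  linear_combination (X a a - star ω * X a b - ω * X b a + ω * star ω * X b b) * hs

end planeHadamard

section Haar

variable {d : ℕ}

/-- The conjugate `UρU*` of `ρ` by a unitary matrix `U`. -/
def conjBy (ρ : Matrix (Fin d) (Fin d) ℂ) (U : Matrix.unitaryGroup (Fin d) ℂ) :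
    Matrix (Fin d) (Fin d) ℂ :=
  (U : Matrix (Fin d) (Fin d) ℂ) * ρ * (U : Matrix (Fin d) (Fin d) ℂ)ᴴ

lemma conjBy_mul (ρ : Matrix (Fin d) (Fin d) ℂ) (V U : Matrix.unitaryGroup (Fin d) ℂ) :
    conjBy ρ (V * U) =
      (V : Matrix (Fin d) (Fin d) ℂ) * conjBy ρ U * (V : Matrix (Fin d) (Fin d) ℂ)ᴴ := by
  simp [conjBy, Matrix.conjTranspose_mul, Matrix.mul_assoc]

lemma conjTranspose_mul_self_unitary (U : Matrix.unitaryGroup (Fin d) ℂ) :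
    (U : Matrix (Fin d) (Fin d) ℂ)ᴴ * (U : Matrix (Fin d) (Fin d) ℂ) = 1 :=
  Matrix.mem_unitaryGroup_iff'.1 U.2

lemma trace_conjBy (ρ : Matrix (Fin d) (Fin d) ℂ) (U : Matrix.unitaryGroup (Fin d) ℂ) :
    (conjBy ρ U).trace = ρ.trace := by
  rw [conjBy, Matrix.trace_mul_comm, ← Matrix.mul_assoc, conjTranspose_mul_self_unitary,
    Matrix.one_mul]

lemma conjBy_mul_conjBy (ρ σ : Matrix (Fin d) (Fin d) ℂ) (U : Matrix.unitaryGroup (Fin d) ℂ) :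
    conjBy ρ U * conjBy σ U = conjBy (ρ * σ) U := by
  have h := conjTranspose_mul_self_unitary U
  simp only [conjBy]
  calc _ = (U : Matrix (Fin d) (Fin d) ℂ) * ρ *
        ((U : Matrix (Fin d) (Fin d) ℂ)ᴴ * (U : Matrix (Fin d) (Fin d) ℂ)) * σ *
        (U : Matrix (Fin d) (Fin d) ℂ)ᴴ := by simp only [Matrix.mul_assoc]
    _ = _ := by rw [h]; simp only [Matrix.mul_assoc, Matrix.one_mul]

lemma measurable_unitary_entry (i j : Fin d) :
    Measurable fun U : Matrix.unitaryGroup (Fin d) ℂ => (U : Matrix (Fin d) (Fin d) ℂ) i j :=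
  (measurable_pi_apply j).comp ((measurable_pi_apply i).comp measurable_subtype_coe)

lemma conjBy_apply (ρ : Matrix (Fin d) (Fin d) ℂ) (U : Matrix.unitaryGroup (Fin d) ℂ)
    (i j : Fin d) :
    conjBy ρ U i j = ∑ l, (∑ k, (U : Matrix (Fin d) (Fin d) ℂ) i k * ρ k l) *
      star ((U : Matrix (Fin d) (Fin d) ℂ) j l) := rfl

lemma measurable_conjBy_entry (ρ : Matrix (Fin d) (Fin d) ℂ) (i j : Fin d) :
    Measurable fun U => conjBy ρ U i j := by
  simp only [conjBy_apply]
  exact Finset.measurable_sum _ fun l _ =>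
    (Finset.measurable_sum _ fun k _ => (measurable_unitary_entry i k).mul_const _).mul
      (continuous_star.measurable.comp (measurable_unitary_entry j l))

lemma norm_conjBy_entry_le (ρ : Matrix (Fin d) (Fin d) ℂ) (U : Matrix.unitaryGroup (Fin d) ℂ)
    (i j : Fin d) : ‖conjBy ρ U i j‖ ≤ ∑ l, ∑ k, ‖ρ k l‖ := by
  rw [conjBy_apply]
  refine (norm_sum_le _ _).trans (Finset.sum_le_sum fun l _ => ?_)
  rw [norm_mul, norm_star]
  refine (mul_le_of_le_one_right (norm_nonneg _) (entry_norm_bound_of_unitary U.2 j l)).trans ?_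
  refine (norm_sum_le _ _).trans (Finset.sum_le_sum fun k _ => ?_)
  rw [norm_mul]
  exact mul_le_of_le_one_left (norm_nonneg _) (entry_norm_bound_of_unitary U.2 i k)

lemma integrable_conjBy_mul (μ : Measure (Matrix.unitaryGroup (Fin d) ℂ)) [IsFiniteMeasure μ]
    (ρ σ : Matrix (Fin d) (Fin d) ℂ) (i j k l : Fin d) :
    Integrable (fun U => conjBy ρ U i j * conjBy σ U k l) μ := by
  refine Integrable.of_bound ((measurable_conjBy_entry ρ i j).mul
    (measurable_conjBy_entry σ k l)).aestronglyMeasurable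
    ((∑ l, ∑ k, ‖ρ k l‖) * ∑ l, ∑ k, ‖σ k l‖) (ae_of_all _ fun U => ?_)
  rw [norm_mul]
  exact mul_le_mul (norm_conjBy_entry_le ρ U i j) (norm_conjBy_entry_le σ U k l)
    (norm_nonneg _) ((norm_nonneg _).trans (norm_conjBy_entry_le ρ U i j))

lemma measurable_unitary_mul_left (V : Matrix.unitaryGroup (Fin d) ℂ) :
    Measurable fun U : Matrix.unitaryGroup (Fin d) ℂ => V * U := by
  refine Measurable.subtype_mk (measurable_pi_lambda _ fun i => measurable_pi_lambda _ fun j => ?_)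
  exact Finset.measurable_sum Finset.univ fun k _ =>
    (measurable_unitary_entry k j).const_mul ((V : Matrix (Fin d) (Fin d) ℂ) i k)

lemma IsHaarOnUnitary.integral_mul_left {μ : Measure (Matrix.unitaryGroup (Fin d) ℂ)}
    (hμ : IsHaarOnUnitary d μ) {f : Matrix.unitaryGroup (Fin d) ℂ → ℂ} (hf : Measurable f)
    (V : Matrix.unitaryGroup (Fin d) ℂ) : ∫ U, f (V * U) ∂μ = ∫ U, f U ∂μ := by
  conv_rhs => rw [← hμ.2 V]
  exact (integral_map (measurable_unitary_mul_left V).aemeasurable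
    hf.aestronglyMeasurable).symm

/-- Averaging over the rotations of one coordinate plane relates the diagonal second moments
to the mixed ones. -/
lemma IsHaarOnUnitary.plane_moments {μ : Measure (Matrix.unitaryGroup (Fin d) ℂ)}
    (hμ : IsHaarOnUnitary d μ) (ρ σ : Matrix (Fin d) (Fin d) ℂ) {a b : Fin d} (hab : a ≠ b) :
    ∫ U, conjBy ρ U a a * conjBy σ U a a ∂μ + ∫ U, conjBy ρ U b b * conjBy σ U b b ∂μ =
      ∫ U, conjBy ρ U a a * conjBy σ U b b ∂μ + ∫ U, conjBy ρ U b b * conjBy σ U a a ∂μ +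
      (∫ U, conjBy ρ U a b * conjBy σ U b a ∂μ + ∫ U, conjBy ρ U b a * conjBy σ U a b ∂μ) := by
  have := hμ.1
  have hInt := integrable_conjBy_mul μ ρ σ
  have hone : (1 : ℂ) * star 1 = 1 := by simp
  have hI : Complex.I * star Complex.I = 1 := by simp
  let V₁ : Matrix.unitaryGroup (Fin d) ℂ := ⟨_, planeHadamard_mem hab hone⟩
  let V₂ : Matrix.unitaryGroup (Fin d) ℂ := ⟨_, planeHadamard_mem hab hI⟩
  let g : Matrix.unitaryGroup (Fin d) ℂ → ℂ := fun U =>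
    conjBy ρ U a a * conjBy σ U a a + conjBy ρ U b b * conjBy σ U b b
  let h : Matrix.unitaryGroup (Fin d) ℂ → ℂ := fun U =>
    conjBy ρ U a a * conjBy σ U b b + conjBy ρ U b b * conjBy σ U a a +
      (conjBy ρ U a b * conjBy σ U b a + conjBy ρ U b a * conjBy σ U a b)
  have hgm : Measurable g :=
    ((measurable_conjBy_entry ρ a a).mul (measurable_conjBy_entry σ a a)).add
      ((measurable_conjBy_entry ρ b b).mul (measurable_conjBy_entry σ b b))
  have hg : Integrable g μ := (hInt a a a a).add (hInt b b b b)
  have hpt : ∀ U, g (V₂ * U) = g U + h U - g (V₁ * U) := by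
    intro U
    simp only [g, h, conjBy_mul, V₁, V₂, planeHadamard_conj_left hab, planeHadamard_conj_right]
    simp only [star_one, Complex.star_def, Complex.conj_I]
    ring_nf
    simp only [Complex.I_sq, Complex.I_pow_four]
    ring
  have hh₁ := (hInt a a b b).add (hInt b b a a)
  have hh₂ := (hInt a b b a).add (hInt b a a b)
  have hh : Integrable h μ := hh₁.add hh₂
  have hg₁ : Integrable (fun U => g (V₁ * U)) μ := by
    have : Integrable g (μ.map fun U => V₁ * U) := by rwa [hμ.2 V₁]
    exact this.comp_measurable (measurable_unitary_mul_left V₁)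
  have e := hμ.integral_mul_left hgm V₂
  simp only [hpt] at e
  rw [integral_sub (f := fun U => g U + h U) (hg.add hh) hg₁, integral_add hg hh, hμ.integral_mul_left hgm V₁] at e
  have e' : ∫ U, g U ∂μ = ∫ U, h U ∂μ := by linear_combination -e
  rw [← integral_add (hInt a a a a) (hInt b b b b), ← integral_add (hInt a a b b) (hInt b b a a),
    ← integral_add (hInt a b b a) (hInt b a a b)]
  exact e'.trans (integral_add hh₁ hh₂)

end Haar

/-- Haar average of the inner product of outcome distributions:
`∫ Σ_b (UρU*)_{bb}(UσU*)_{bb} dμ_H(U) = (1 + Tr(ρσ))/(d+1)`. -/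
theorem stmt12 (d : ℕ) (hd : 1 ≤ d)
    (μH : Measure (Matrix.unitaryGroup (Fin d) ℂ)) (hμH : IsHaarOnUnitary d μH)
    (ρ σ : Matrix (Fin d) (Fin d) ℂ) (hρ : ρ.PosSemidef) (hσ : σ.PosSemidef)
    (hρ1 : ρ.trace = 1) (hσ1 : σ.trace = 1) :
    (∫ U : Matrix.unitaryGroup (Fin d) ℂ,
        ∑ b : Fin d, (((U : Matrix (Fin d) (Fin d) ℂ) * ρ * (U : Matrix (Fin d) (Fin d) ℂ)ᴴ) b b *
          ((U : Matrix (Fin d) (Fin d) ℂ) * σ * (U : Matrix (Fin d) (Fin d) ℂ)ᴴ) b b) ∂μH)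
      = (1 + (ρ * σ).trace) / ((d : ℂ) + 1) := by
  have := hμH.1
  have hInt := integrable_conjBy_mul μH ρ σ
  let G : Fin d → Fin d → ℂ := fun a b => ∫ U, conjBy ρ U a a * conjBy σ U b b ∂μH
  let C : Fin d → Fin d → ℂ := fun a b => ∫ U, conjBy ρ U a b * conjBy σ U b a ∂μH
  have hG : ∑ a, ∑ b, G a b = 1 := by
    have : ∀ U, ∑ a, ∑ b, conjBy ρ U a a * conjBy σ U b b = 1 := fun U => by
      rw [← Finset.sum_mul_sum]
      change (conjBy ρ U).trace * (conjBy σ U).trace = 1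
      rw [trace_conjBy, trace_conjBy, hρ1, hσ1, one_mul]
    calc ∑ a, ∑ b, G a b = ∫ U, ∑ a, ∑ b, conjBy ρ U a a * conjBy σ U b b ∂μH := by
          rw [integral_finsetSum _ fun a _ => integrable_finsetSum _ fun b _ => hInt a a b b]
          exact Finset.sum_congr rfl fun a _ =>
            (integral_finsetSum _ fun b _ => hInt a a b b).symm
      _ = 1 := by simp [this]
  have hC : ∑ a, ∑ b, C a b = (ρ * σ).trace := by
    have : ∀ U, ∑ a, ∑ b, conjBy ρ U a b * conjBy σ U b a = (ρ * σ).trace := fun U => by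
      rw [← trace_conjBy (ρ * σ) U, ← conjBy_mul_conjBy]
      rfl
    calc ∑ a, ∑ b, C a b = ∫ U, ∑ a, ∑ b, conjBy ρ U a b * conjBy σ U b a ∂μH := by
          rw [integral_finsetSum _ fun a _ => integrable_finsetSum _ fun b _ => hInt a b b a]
          exact Finset.sum_congr rfl fun a _ =>
            (integral_finsetSum _ fun b _ => hInt a b b a).symm
      _ = (ρ * σ).trace := by simp [this]
  have hpair : ∀ a b, G a a + G b b + (if a = b then 2 * G a a else 0) =
      G a b + G b a + (C a b + C b a) := by
    intro a b
    by_cases hab : a = b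
    · subst hab
      have : C a a = G a a := rfl
      rw [if_pos rfl, this]
      ring
    · rw [if_neg hab, add_zero]
      exact hμH.plane_moments ρ σ hab
  have hsum : ∑ a, ∑ b, (G a a + G b b + (if a = b then 2 * G a a else 0)) =
      ∑ a, ∑ b, (G a b + G b a + (C a b + C b a)) :=
    Finset.sum_congr rfl fun a _ => Finset.sum_congr rfl fun b _ => hpair a b
  have hG' : ∑ a, ∑ b, G b a = 1 := by rw [Finset.sum_comm, hG]
  have hC' : ∑ a, ∑ b, C b a = (ρ * σ).trace := by rw [Finset.sum_comm, hC]
  simp only [Finset.sum_add_distrib, hG, hG', hC, hC'] at hsum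
  simp only [Finset.sum_const, Finset.card_univ, Fintype.card_fin, nsmul_eq_mul,
    Finset.sum_ite_eq, Finset.mem_univ, if_true, ← Finset.mul_sum] at hsum
  have hd0 : (d : ℂ) + 1 ≠ 0 := by exact_mod_cast Nat.succ_ne_zero d
  rw [eq_div_iff hd0]
  have hL := integral_finsetSum (μ := μH) Finset.univ fun b _ => hInt b b b b
  refine (congrArg (· * ((d : ℂ) + 1)) hL).trans ?_
  change (∑ b, G b b) * ((d : ℂ) + 1) = _
  linear_combination hsum / 2

end
end
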